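/- Fix a real R > 0 and an integer b ≥ 1. There exists a constant C = C(R, b) > 0 such that uniformly for all real x ≥ 3 and all integers k₁, k₂ with 1 ≤ k₁, k₂ ≤ R·log₂x, the number of integers n ∈ (x, 2x] with ω(n) = k₁ and ω(n+b) = k₂ is at most C·δ_{k₁}(x)·δ_{k₂}(x)·x. -/

import Mathlib

open scoped Classical BigOperators
open MeasureTheory

/-- Number of distinct prime factors. -/
noncomputable def smallOmega (n : ℕ) : ℕ := n.primeFactors.card

/-- `π_k(x)`: number of integers `n ≤ x` with `ω(n) = k`. -/
noncomputable def pik (k : ℕ) (x : ℝ) : ℕ :=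
  ((Finset.Icc 1 ⌊x⌋₊).filter (fun n => smallOmega n = k)).card

/-- Iterated logarithm `log₂ = log ∘ log`. -/
noncomputable def log₂ (x : ℝ) : ℝ := Real.log (Real.log x)

/-- `λ(z) = Γ(z+1)⁻¹ ∏_p (1 + z/(p-1)) (1 - 1/p)^z`. -/
noncomputable def lambdaFn (z : ℝ) : ℝ :=
  (Real.Gamma (z + 1))⁻¹ *
    ∏' p : Nat.Primes, ((1 + z / (((p : ℕ) : ℝ) - 1)) * (1 - 1 / ((p : ℕ) : ℝ)) ^ z)

/-- `δ_k(x) = λ(κ) (log₂ x)^{k-1} / ((log x) (k-1)!)`, with `κ = (k-1)/log₂ x`. -/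
noncomputable def deltak (k : ℕ) (x : ℝ) : ℝ :=
  lambdaFn (((k : ℝ) - 1) / log₂ x) * (log₂ x) ^ (k - 1) /
    (Real.log x * (Nat.factorial (k - 1) : ℝ))

theorem m1_aux (N : ℕ) : ∑ p ∈ (N+1).primesBelow, Real.log p * (N / p : ℕ) ≤ ∑ n ∈ Finset.Ioc 0 N, Real.log n := by
  have h1 : ∀ n ∈ Finset.Ioc 0 N, ∑ p ∈ (N+1).primesBelow, (if p ∣ n then Real.log p else 0) ≤ Real.log n := by
    intro n hn
    rw [Finset.mem_Ioc] at hn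
    rw [← Finset.sum_filter]
    have hs : ((N+1).primesBelow.filter (fun p => p ∣ n)) ⊆ n.primeFactors := by
      intro p hp
      rw [Finset.mem_filter, Nat.mem_primesBelow] at hp
      exact Nat.mem_primeFactors.2 ⟨hp.1.2, hp.2, by omega⟩
    calc _ ≤ ∑ p ∈ n.primeFactors, Real.log p := by
          apply Finset.sum_le_sum_of_subset_of_nonneg hs
          intro p _ _; exact Real.log_natCast_nonneg p
      _ = Real.log (∏ p ∈ n.primeFactors, (p:ℝ)) := by
          rw [Real.log_prod]
          intro p hp
          exact_mod_cast (Nat.prime_of_mem_primeFactors hp).ne_zero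
      _ ≤ Real.log n := by
          apply Real.log_le_log
          · apply Finset.prod_pos; intro p hp
            exact_mod_cast (Nat.prime_of_mem_primeFactors hp).pos
          · rw [← Nat.cast_prod]
            exact_mod_cast Nat.le_of_dvd hn.1 (Nat.prod_primeFactors_dvd n)
  refine le_trans (le_of_eq ?_) (Finset.sum_le_sum h1)
  rw [Finset.sum_comm]
  apply Finset.sum_congr rfl
  intro p hp
  rw [← Finset.sum_filter, Finset.sum_const, Nat.Ioc_filter_dvd_card_eq_div, nsmul_eq_mul, mul_comm]

theorem m1 (N : ℕ) (hN : 1 ≤ N) : ∑ p ∈ (N+1).primesBelow, Real.log p / p ≤ 2 * Real.log N := by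
  have hN0 : (0:ℝ) < N := by exact_mod_cast hN
  have h := m1_aux N
  have h2 : ∑ n ∈ Finset.Ioc 0 N, Real.log n ≤ N * Real.log N := by
    calc _ ≤ ∑ n ∈ Finset.Ioc 0 N, Real.log N := by
          apply Finset.sum_le_sum; intro n hn
          rw [Finset.mem_Ioc] at hn
          apply Real.log_le_log
          · exact_mod_cast hn.1
          · exact_mod_cast hn.2
      _ = _ := by simp
  have h3 : ∑ p ∈ (N+1).primesBelow, (N/2 : ℝ) * (Real.log p / p) ≤ ∑ p ∈ (N+1).primesBelow, Real.log p * (N / p : ℕ) := by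
    apply Finset.sum_le_sum
    intro p hp
    rw [Nat.mem_primesBelow] at hp
    have hp0 : 0 < p := hp.2.pos
    have hq : N < p * (N/p) + p := by
      have := Nat.div_add_mod N p; have := Nat.mod_lt N hp0; omega
    have hq1 : 1 ≤ N / p := (Nat.one_le_div_iff hp0).2 (by omega)
    have hq2 : N ≤ 2 * (p * (N/p)) := by nlinarith
    have hq3 : (N:ℝ) ≤ 2 * (p * (N/p : ℕ)) := by exact_mod_cast hq2
    have hp0' : (0:ℝ) < p := by exact_mod_cast hp0
    have hl := Real.log_natCast_nonneg p
    rw [mul_div_assoc', div_le_iff₀ hp0']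
    nlinarith
  rw [← Finset.mul_sum] at h3
  have : (N/2 : ℝ) * (∑ p ∈ (N+1).primesBelow, Real.log p / p) ≤ (N/2:ℝ) * (2 * Real.log N) := by linarith
  exact le_of_mul_le_mul_left this (by positivity)

noncomputable def powHom (s : ℝ) : ℕ →* ℝ where
  toFun n := (n:ℝ) ^ (-s)
  map_one' := by simp
  map_mul' a b := by push_cast; rw [Real.mul_rpow] <;> positivity

theorem powHom_hasSum (s : ℝ) (hs : 0 < s) (N : ℕ) :
    HasSum ((N.smoothNumbers).indicator (fun n : ℕ => (n:ℝ) ^ (-s)))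
      (∏ p ∈ N.primesBelow, (1 - (p:ℝ)^(-s))⁻¹) := by
  have h := (EulerProduct.summable_and_hasSum_smoothNumbers_prod_primesBelow_geometric
    (f := powHom s) (fun {p} hp => by
      have : (powHom s p) = (p:ℝ)^(-s) := rfl
      rw [this, Real.norm_of_nonneg (by positivity)]
      apply Real.rpow_lt_one_of_one_lt_of_neg
      · exact_mod_cast hp.one_lt
      · linarith) N).2
  exact hasSum_subtype_iff_indicator.1 h

theorem m2 (N : ℕ) (hN : 1 ≤ N) : Real.log N ≤ ∏ p ∈ (N+1).primesBelow, (1 - 1/(p:ℝ))⁻¹ := by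
  have h := powHom_hasSum 1 one_pos (N+1)
  have h1 : ∑ n ∈ Finset.Icc 1 N, ((n:ℝ))⁻¹ ≤ ∏ p ∈ (N+1).primesBelow, (1 - (p:ℝ)^(-1:ℝ))⁻¹ := by
    refine le_trans (le_of_eq ?_) (sum_le_hasSum (Finset.Icc 1 N) ?_ h)
    · apply Finset.sum_congr rfl
      intro n hn
      rw [Finset.mem_Icc] at hn
      rw [Set.indicator_of_mem (Nat.mem_smoothNumbers_of_lt (by omega) (by omega)), Real.rpow_neg_one]
    · intro n _
      apply Set.indicator_nonneg; intro n _; positivity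
  have h2 := log_add_one_le_harmonic N
  rw [harmonic_eq_sum_Icc] at h2
  push_cast at h2
  have h3 : Real.log N ≤ Real.log (N+1) := Real.log_le_log (by exact_mod_cast hN) (by linarith)
  simp only [Real.rpow_neg_one] at h1
  simp only [one_div]
  linarith

theorem m3_zeta (s : ℝ) (hs : 1 < s) (N : ℕ) :
    ∏ p ∈ N.primesBelow, (1 - (p:ℝ)^(-s))⁻¹ ≤ 1 + 1/(s-1) := by
  have h := powHom_hasSum s (by linarith) N
  have hsum : Summable (fun n : ℕ => (n:ℝ)^(-s)) := Real.summable_nat_rpow.2 (by linarith)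
  have h1 := hasSum_le (fun n => Set.indicator_le_self' (fun _ _ => by positivity) n) h hsum.hasSum
  have h2 := ZetaAsymptotics.zeta_limit_aux1 hs
  have h3 : 0 ≤ ZetaAsymptotics.termTSum s := tsum_nonneg fun n => ZetaAsymptotics.term_nonneg _ _
  have h4 : ∑' n : ℕ, (n:ℝ)^(-s) = ∑' n : ℕ, 1 / ((n:ℝ)+1)^s := by
    rw [hsum.tsum_eq_zero_add]
    have : (-s) ≠ 0 := by linarith
    simp only [Nat.cast_zero, Real.zero_rpow this, zero_add]
    congr 1; ext n
    rw [Real.rpow_neg (by positivity)]; push_cast; rw [one_div]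
  rw [h4] at h1
  have h5 : 0 ≤ s * ZetaAsymptotics.termTSum s := mul_nonneg (by linarith) h3
  linarith

theorem m3 : ∃ C : ℝ, 0 < C ∧ ∀ x : ℝ, 3 ≤ x →
    ∑ p ∈ (⌊x⌋₊+1).primesBelow, 1/(p:ℝ) ≤ Real.log (Real.log x) + C := by
  refine ⟨3, by norm_num, fun x hx => ?_⟩
  have hl : 1 < Real.log x := by
    rw [Real.lt_log_iff_exp_lt (by linarith)]
    linarith [Real.exp_one_lt_d9]
  set s := 1 + 1/Real.log x with hs
  have hi : 0 < 1 / Real.log x := by positivity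
  have hs1 : 1 < s := by linarith
  set N := ⌊x⌋₊ with hN
  have hN1 : 1 ≤ N := Nat.le_floor (by push_cast; linarith)
  have hNx : (N:ℝ) ≤ x := Nat.floor_le (by linarith)
  have hz := m3_zeta s hs1 (N+1)
  have hs2 : 1/(s-1) = Real.log x := by rw [hs]; simp
  rw [hs2] at hz
  have hfac : ∀ p ∈ (N+1).primesBelow, 0 < 1 - (p:ℝ)^(-s) := by
    intro p hp
    have hp := (Nat.mem_primesBelow.1 hp).2
    have := Real.rpow_lt_one_of_one_lt_of_neg (x := (p:ℝ)) (z := -s) (by exact_mod_cast hp.one_lt) (by linarith)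
    linarith
  have h1 : ∑ p ∈ (N+1).primesBelow, (p:ℝ)^(-s) ≤ Real.log (1 + Real.log x) := by
    calc _ ≤ ∑ p ∈ (N+1).primesBelow, Real.log ((1 - (p:ℝ)^(-s))⁻¹) := by
          apply Finset.sum_le_sum; intro p hp
          rw [Real.log_inv]
          have := Real.log_le_sub_one_of_pos (hfac p hp)
          linarith
      _ = Real.log (∏ p ∈ (N+1).primesBelow, (1 - (p:ℝ)^(-s))⁻¹) := by
          rw [Real.log_prod]; intro p hp; exact inv_ne_zero (hfac p hp).ne'
      _ ≤ _ := by
          apply Real.log_le_log _ hz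
          apply Finset.prod_pos; intro p hp; exact inv_pos.2 (hfac p hp)
  have h2 : Real.log (1 + Real.log x) ≤ Real.log (Real.log x) + 1 := by
    have : Real.log (1 + Real.log x) ≤ Real.log (2 * Real.log x) := Real.log_le_log (by linarith) (by linarith)
    rw [Real.log_mul (by norm_num) (by linarith)] at this
    linarith [Real.log_two_lt_d9]
  have h3 : ∑ p ∈ (N+1).primesBelow, (1/(p:ℝ) - (p:ℝ)^(-s)) ≤ ∑ p ∈ (N+1).primesBelow, (Real.log p / p) * (1/Real.log x) := by
    apply Finset.sum_le_sum; intro p hp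
    have hp := (Nat.mem_primesBelow.1 hp).2
    have hp0 : (0:ℝ) < p := by exact_mod_cast hp.pos
    have e1 : (p:ℝ)^(-s) = 1/p * Real.exp (-(Real.log p * (1/Real.log x))) := by
      rw [hs, neg_add, Real.rpow_add hp0, Real.rpow_neg_one, one_div, Real.rpow_def_of_pos hp0]
      congr 2 <;> ring
    have e2 := Real.add_one_le_exp (-(Real.log p * (1/Real.log x)))
    rw [e1]
    have : 1/(p:ℝ) * (-(Real.log p * (1/Real.log x)) + 1) ≤ 1/p * Real.exp (-(Real.log p * (1/Real.log x))) :=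
      mul_le_mul_of_nonneg_left e2 (by positivity)
    have e3 : Real.log p / p * (1/Real.log x) = 1/p * (Real.log p * (1/Real.log x)) := by ring
    rw [e3]; linarith
  rw [← Finset.sum_mul, Finset.sum_sub_distrib] at h3
  have h4 := m1 N hN1
  have h5 : Real.log N ≤ Real.log x := Real.log_le_log (by exact_mod_cast hN1) hNx
  have h6 : (∑ p ∈ (N+1).primesBelow, Real.log p / p) * (1/Real.log x) ≤ 2 := by
    rw [mul_one_div, div_le_iff₀ (by linarith)]; linarith
  linarith

theorem lam_factor (R z : ℝ) (hz : 0 ≤ z) (hzR : z ≤ R) (p : ℕ) (hp : p.Prime) :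
    Real.exp (-(R^2 * (1/((p-1:ℕ):ℝ)^2))) ≤ (1 + z / ((p:ℝ) - 1)) * (1 - 1 / (p:ℝ)) ^ z := by
  have hp2 : (2:ℝ) ≤ p := by exact_mod_cast hp.two_le
  have hpc : ((p-1:ℕ):ℝ) = (p:ℝ) - 1 := by rw [Nat.cast_sub hp.one_le]; simp
  rw [hpc]
  set m := (p:ℝ) - 1 with hm
  have hm1 : 1 ≤ m := by linarith
  have hpm : (p:ℝ) = m + 1 := by linarith
  rw [hpm]
  set u := z / m with hu
  have hu0 : 0 ≤ u := by positivity
  have h1 : Real.exp (u - u^2) ≤ 1 + u := by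
    have := Real.one_sub_inv_le_log_of_pos (show 0 < 1 + u by linarith)
    have h2 : u - u^2 ≤ 1 - (1+u)⁻¹ := by
      have : 1 - (1+u)⁻¹ = u / (1+u) := by field_simp; ring
      rw [this, le_div_iff₀ (by linarith)]
      nlinarith [mul_nonneg hu0 (mul_nonneg hu0 hu0)]
    rw [← Real.le_log_iff_exp_le (by linarith)]; linarith
  have h2 : Real.exp (-u) ≤ (1 - 1/(m+1))^z := by
    have e : 1 - 1/(m+1) = (1 + 1/m)⁻¹ := by field_simp; ring
    rw [e, Real.rpow_def_of_pos (by positivity), Real.log_inv]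
    apply Real.exp_le_exp.2
    have := Real.log_le_sub_one_of_pos (show 0 < 1 + 1/m by positivity)
    have h3 : Real.log (1+1/m) * z ≤ (1/m) * z := mul_le_mul_of_nonneg_right (by linarith) hz
    have h4 : u = 1/m * z := by rw [hu]; ring
    linarith
  calc Real.exp (-(R^2 * (1/m^2))) ≤ Real.exp ((u - u^2) + (-u)) := by
        apply Real.exp_le_exp.2
        have : u^2 = z^2 * (1/m^2) := by rw [hu]; ring
        have h5 : z^2 * (1/m^2) ≤ R^2 * (1/m^2) := by
          apply mul_le_mul_of_nonneg_right _ (by positivity)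
          exact pow_le_pow_left₀ hz hzR 2
        linarith
    _ = Real.exp (u-u^2) * Real.exp (-u) := Real.exp_add _ _
    _ ≤ _ := mul_le_mul h1 h2 (Real.exp_pos _).le (by linarith)

theorem lam_lb (R : ℝ) (hR : 0 < R) : ∃ c : ℝ, 0 < c ∧ ∀ z : ℝ, 0 ≤ z → z ≤ R → c ≤ lambdaFn z := by
  have hsum : Summable (fun p : Nat.Primes => 1/(((p:ℕ)-1:ℕ):ℝ)^2) := by
    have h := (Real.summable_one_div_nat_pow (p := 2)).2 (by norm_num)
    exact h.comp_injective (i := fun p : Nat.Primes => (p:ℕ)-1) (by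
      intro p q hpq
      have h1 := p.2.one_le; have h2 := q.2.one_le
      dsimp at hpq
      exact Subtype.ext (by omega))
  set S := ∑' p : Nat.Primes, 1/(((p:ℕ)-1:ℕ):ℝ)^2 with hS
  have hS0 : 0 ≤ S := tsum_nonneg fun p => by positivity
  obtain ⟨G, hG⟩ := (isCompact_Icc (a := (1:ℝ)) (b := R+1)).exists_bound_of_continuousOn (f := Real.Gamma) (by
    intro t ht
    apply ContinuousAt.continuousWithinAt
    apply (Real.differentiableAt_Gamma (fun m => _)).continuousAt
    intro m
    have := ht.1
    have : (0:ℝ) ≤ m := by positivity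
    linarith)
  have hG1 : 0 < G := by
    have := hG 1 ⟨le_refl _, by linarith⟩
    rw [Real.Gamma_one] at this
    simp at this; linarith
  refine ⟨G⁻¹ * Real.exp (-(R^2*S)), by positivity, fun z hz hzR => ?_⟩
  unfold lambdaFn
  have hg0 : 0 < Real.Gamma (z+1) := Real.Gamma_pos_of_pos (by linarith)
  have hg : (Real.Gamma (z+1)) ≤ G := by
    have := hG (z+1) ⟨by linarith, by linarith⟩
    rwa [Real.norm_of_nonneg hg0.le] at this
  apply mul_le_mul _ _ (Real.exp_pos _).le (by positivity)
  · exact inv_anti₀ hg0 hg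
  · by_cases hm : Multipliable (fun p : Nat.Primes => ((1 + z / (((p : ℕ) : ℝ) - 1)) * (1 - 1 / ((p : ℕ) : ℝ)) ^ z))
    · refine ge_of_tendsto' hm.hasProd (fun s => ?_)
      calc Real.exp (-(R^2*S)) ≤ Real.exp (∑ p ∈ s, (-(R^2 * (1/(((p:ℕ)-1:ℕ):ℝ)^2)))) := by
            apply Real.exp_le_exp.2
            rw [Finset.sum_neg_distrib, ← Finset.mul_sum]
            have := hsum.sum_le_tsum s (fun p _ => by positivity)
            have := mul_le_mul_of_nonneg_left this (sq_nonneg R)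
            linarith
        _ = ∏ p ∈ s, Real.exp (-(R^2 * (1/(((p:ℕ)-1:ℕ):ℝ)^2))) := Real.exp_sum _ _
        _ ≤ _ := Finset.prod_le_prod (fun p _ => (Real.exp_pos _).le) (fun p _ => lam_factor R z hz hzR p p.2)
    · rw [tprod_eq_one_of_not_multipliable hm]
      apply Real.exp_le_one_iff.2
      have := mul_nonneg (sq_nonneg R) hS0
      linarith

theorem m5 (f : ℕ → ℝ) (hf : ∀ n, 0 ≤ f n) (hf1 : f 1 = 1)
    (hmul : ∀ a b : ℕ, Nat.Coprime a b → f (a*b) = f a * f b) (Q : Finset ℕ) (N : ℕ) (j : ℕ) :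
    ∑ a ∈ (Finset.Icc 1 N).filter (fun a => a.primeFactors ⊆ Q ∧ a.primeFactors.card = j), f a ≤
      (∑ p ∈ Q, ∑ e ∈ Finset.Icc 1 N, f (p^e))^j / (j.factorial : ℝ) := by
  set G := ∑ p ∈ Q, ∑ e ∈ Finset.Icc 1 N, f (p^e) with hG
  have hG0 : 0 ≤ G := Finset.sum_nonneg fun p _ => Finset.sum_nonneg fun e _ => hf _
  induction j with
  | zero =>
    have : (Finset.Icc 1 N).filter (fun a => a.primeFactors ⊆ Q ∧ a.primeFactors.card = 0) ⊆ {1} := by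
      intro a ha
      simp only [Finset.mem_filter, Finset.mem_Icc, Finset.card_eq_zero, Nat.primeFactors_eq_empty] at ha
      simp; omega
    refine le_trans (Finset.sum_le_sum_of_subset_of_nonneg this (fun _ _ _ => hf _)) ?_
    simp [hf1]
  | succ j ih =>
    set A := fun j => (Finset.Icc 1 N).filter (fun a => a.primeFactors ⊆ Q ∧ a.primeFactors.card = j) with hA
    have key : ((j+1:ℕ):ℝ) * ∑ a ∈ A (j+1), f a ≤ G * ∑ a ∈ A j, f a := by
      let S := (A (j+1)).sigma (fun a => a.primeFactors)
      let i : (Σ _ : ℕ, ℕ) → (ℕ × ℕ) × ℕ := fun s => ((s.2, s.1.factorization s.2), s.1 / s.2 ^ (s.1.factorization s.2))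
      have hS : ∀ s ∈ S, s.1 ∈ A (j+1) ∧ s.2 ∈ s.1.primeFactors := fun s hs => Finset.mem_sigma.1 hs
      have hprod : ∀ s ∈ S, (s.2)^(s.1.factorization s.2) * (s.1 / s.2 ^ (s.1.factorization s.2)) = s.1 := by
        intro s hs
        exact Nat.ordProj_mul_ordCompl_eq_self _ _
      have hinj : Set.InjOn i S := by
        intro s hs t ht hst
        have h1 := hprod s hs
        have h2 := hprod t ht
        simp only [i, Prod.mk.injEq] at hst
        obtain ⟨⟨h3, h4⟩, h5⟩ := hst
        rw [h5, h4, h3, h2] at h1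
        cases s; cases t; simp_all
      have e1 : ((j+1:ℕ):ℝ) * ∑ a ∈ A (j+1), f a = ∑ s ∈ S, (f (s.2^(s.1.factorization s.2)) * f (s.1 / s.2 ^ (s.1.factorization s.2))) := by
        rw [Finset.sum_sigma, Finset.mul_sum]
        apply Finset.sum_congr rfl
        intro a ha
        have hc : a.primeFactors.card = j+1 := (Finset.mem_filter.1 ha).2.2
        rw [Finset.sum_congr rfl (g := fun _ => f a), Finset.sum_const, hc, nsmul_eq_mul]
        intro p hp
        have hs : (⟨a, p⟩ : Σ _ : ℕ, ℕ) ∈ S := Finset.mem_sigma.2 ⟨ha, hp⟩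
        rw [← hmul, hprod _ hs]
        apply Nat.Coprime.pow_left
        have h0 : a ≠ 0 := (Nat.mem_primeFactors.1 hp).2.2
        exact Nat.coprime_ordCompl (Nat.prime_of_mem_primeFactors hp) h0
      rw [e1]
      have e2 : G * ∑ a ∈ A j, f a = ∑ t ∈ (Q ×ˢ Finset.Icc 1 N) ×ˢ (A j), f (t.1.1^t.1.2) * f t.2 := by
        rw [Finset.sum_product, hG, ← Finset.sum_product', Finset.sum_mul]
        apply Finset.sum_congr rfl; intro t _
        rw [Finset.mul_sum]
      rw [e2]
      have e3 : ∑ s ∈ S, (f (s.2^(s.1.factorization s.2)) * f (s.1 / s.2 ^ (s.1.factorization s.2))) =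
          ∑ t ∈ S.image i, f (t.1.1^t.1.2) * f t.2 := by
        rw [Finset.sum_image hinj]
      rw [e3]
      apply Finset.sum_le_sum_of_subset_of_nonneg
      · intro t ht
        obtain ⟨s, hs, rfl⟩ := Finset.mem_image.1 ht
        obtain ⟨h1, h2⟩ := hS s hs
        obtain ⟨a, p⟩ := s
        simp only [hA, Finset.mem_filter, Finset.mem_Icc] at h1
        dsimp at h1 h2
        have hp := Nat.prime_of_mem_primeFactors h2
        have hdvd := (Nat.mem_primeFactors.1 h2).2.1
        have ha0 : a ≠ 0 := by omega
        simp only [i, Finset.mem_product, hA, Finset.mem_filter, Finset.mem_Icc]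
        have hpf : (a / p ^ a.factorization p).primeFactors = a.primeFactors.erase p := by
          rw [← Nat.support_factorization, Nat.factorization_ordCompl, Finsupp.support_erase, Nat.support_factorization]
        refine ⟨⟨h1.2.1 h2, hp.factorization_pos_of_dvd ha0 hdvd, ?_⟩, ⟨Nat.ordCompl_pos p ha0, ?_⟩, ?_, ?_⟩
        · have := Nat.ordProj_le p ha0
          have := Nat.lt_pow_self hp.one_lt (n := a.factorization p)
          omega
        · exact le_trans (Nat.div_le_self _ _) h1.1.2
        · rw [hpf]; exact (Finset.erase_subset _ _).trans h1.2.1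
        · rw [hpf, Finset.card_erase_of_mem h2, h1.2.2]; simp
      · intro t _ _; exact mul_nonneg (hf _) (hf _)
    have hj : (0:ℝ) < ((j+1:ℕ):ℝ) := by positivity
    have : ∑ a ∈ A (j+1), f a ≤ G * (G^j / j.factorial) / ((j+1:ℕ):ℝ) := by
      rw [le_div_iff₀ hj, mul_comm]
      exact key.trans (mul_le_mul_of_nonneg_left ih hG0)
    refine this.trans (le_of_eq ?_)
    rw [Nat.factorial_succ]; push_cast
    field_simp
    ring

noncomputable def gam (p : ℕ) : ℝ := ((1 - 1/(p:ℝ))⁻¹)^2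

theorem gam_le (p : ℕ) (hp : p.Prime) : gam p ≤ 1 + 6 / p := by
  have hp2 : (2:ℝ) ≤ p := by exact_mod_cast hp.two_le
  unfold gam
  have : (1 - 1/(p:ℝ))⁻¹ = p / (p-1) := by
    have : (p:ℝ) - 1 ≠ 0 := by linarith
    field_simp
  rw [this, div_pow, div_le_iff₀ (by nlinarith)]
  have h : (1 + 6/(p:ℝ)) * (p-1)^2 = ((p+6) * (p-1)^2)/p := by field_simp
  rw [h, le_div_iff₀ (by linarith)]
  nlinarith [mul_nonneg (show (0:ℝ) ≤ p - 2 by linarith) (show (0:ℝ) ≤ p by linarith)]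

theorem gam_nonneg (p : ℕ) : 0 ≤ gam p := sq_nonneg _

noncomputable def gg (a : ℕ) : ℝ := ∏ p ∈ a.primeFactors, gam p

theorem gg_nonneg (a : ℕ) : 0 ≤ gg a := Finset.prod_nonneg fun p _ => gam_nonneg p

theorem gg_mul (a b : ℕ) (h : Nat.Coprime a b) : gg (a*b) = gg a * gg b := by
  unfold gg
  rw [h.primeFactors_mul, Finset.prod_union h.disjoint_primeFactors]

theorem m4_term (B β : ℝ) (hβ : 0 ≤ β) (hβ4 : β ≤ 1/4) (p : ℕ) (hp : p.Prime) (N : ℕ)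
    (hB : β * Real.log p ≤ B) :
    ∑ e ∈ Finset.Icc 1 N, gg (p^e) * ((p^e:ℕ):ℝ)^(β-1) ≤
      1/p + β * Real.exp B * (Real.log p / p) + 18 * (p:ℝ)^(-(3/2):ℝ) := by
  have hp2 : (2:ℝ) ≤ p := by exact_mod_cast hp.two_le
  have hp0 : (0:ℝ) < p := by linarith
  have hp1 : (1:ℝ) ≤ p := by linarith
  set r := (p:ℝ)^(β-1) with hr
  have hr0 : 0 < r := by positivity
  have hr34 : r ≤ (p:ℝ)^(-(3/4):ℝ) := Real.rpow_le_rpow_of_exponent_le hp1 (by linarith)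
  have hr23 : r ≤ 2/3 := by
    have h1 : (p:ℝ)^(-(3/4):ℝ) ≤ (2:ℝ)^(-(3/4):ℝ) := Real.rpow_le_rpow_of_nonpos (by norm_num) hp2 (by norm_num)
    have h2 : (2:ℝ)^(-(3/4):ℝ) ≤ 2/3 := by
      have h3 : ((2:ℝ)^(-(3/4):ℝ))^4 = 1/8 := by
        rw [← Real.rpow_natCast, ← Real.rpow_mul (by norm_num)]; norm_num
      by_contra hc
      push Not at hc
      have := pow_lt_pow_left₀ hc (by norm_num) (show (4:ℕ) ≠ 0 by norm_num)
      rw [h3] at this; norm_num at this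
    linarith
  have hr2 : r^2 ≤ (p:ℝ)^(-(3/2):ℝ) := by
    have := pow_le_pow_left₀ hr0.le hr34 2
    rwa [← Real.rpow_natCast ((p:ℝ)^(-(3/4):ℝ)), ← Real.rpow_mul hp0.le, show (-(3/4):ℝ) * ((2:ℕ):ℝ) = -(3/2) by norm_num] at this
  have hrp : 1/(p:ℝ) * r ≤ (p:ℝ)^(-(3/2):ℝ) := by
    have : 1/(p:ℝ) * r = (p:ℝ)^(β-2) := by
      rw [one_div, ← Real.rpow_neg_one, hr, ← Real.rpow_add hp0]; congr 1; ring
    rw [this]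
    exact Real.rpow_le_rpow_of_exponent_le hp1 (by linarith)
  have hterm : ∀ e ∈ Finset.Icc 1 N, gg (p^e) * ((p^e:ℕ):ℝ)^(β-1) = gam p * r^e := by
    intro e he
    rw [Finset.mem_Icc] at he
    unfold gg
    rw [Nat.primeFactors_prime_pow (by omega) hp, Finset.prod_singleton]
    congr 1
    push_cast
    rw [← Real.rpow_natCast, ← Real.rpow_mul hp0.le, hr, ← Real.rpow_natCast, ← Real.rpow_mul hp0.le, mul_comm]
  rw [Finset.sum_congr rfl hterm, ← Finset.mul_sum]
  have hgeo : ∑ e ∈ Finset.Icc 1 N, r^e ≤ r + 3 * r^2 := by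
    have h1 : ∑ e ∈ Finset.Icc 1 N, r^e = r * ∑ e ∈ Finset.range N, r^e := by
      rw [Finset.mul_sum, Finset.range_eq_Ico]
      have h := Finset.sum_Ico_add' (fun e => r^e) 0 N 1
      have h' : Finset.Icc 1 N = Finset.Ico (0+1) (N+1) := by ext; simp
      rw [h', ← h]
      apply Finset.sum_congr rfl; intros; ring
    have h2 : ∑ e ∈ Finset.range N, r^e ≤ (1-r)⁻¹ := by
      have hs := hasSum_geometric_of_lt_one hr0.le (by linarith : r < 1)
      exact sum_le_hasSum _ (fun _ _ => by positivity) hs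
    have h3 : (1-r)⁻¹ ≤ 1 + 3 * r := by
      rw [inv_le_iff_one_le_mul₀ (by linarith)]; nlinarith
    rw [h1]
    calc r * ∑ e ∈ Finset.range N, r^e ≤ r * (1 + 3*r) := mul_le_mul_of_nonneg_left (h2.trans h3) hr0.le
      _ = _ := by ring
  have hr1 : r ≤ 1/p + β * Real.exp B * (Real.log p / p) := by
    have h1 : r = 1/p * Real.exp (β * Real.log p) := by
      rw [hr, Real.rpow_sub hp0, Real.rpow_one, Real.rpow_def_of_pos hp0]
      rw [mul_comm β]; ring
    have hl : 0 ≤ Real.log p := Real.log_nonneg hp1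
    set t := β * Real.log p with ht
    have ht0 : 0 ≤ t := by positivity
    have h2 : Real.exp t ≤ 1 + t * Real.exp t := by
      have := Real.add_one_le_exp (-t)
      have h3 : Real.exp (-t) * Real.exp t = 1 := by rw [← Real.exp_add]; simp
      nlinarith [Real.exp_pos t]
    have h3 : Real.exp t ≤ Real.exp B := Real.exp_le_exp.2 hB
    have h4 : Real.exp t ≤ 1 + t * Real.exp B := by nlinarith
    rw [h1]
    calc 1/(p:ℝ) * Real.exp t ≤ 1/p * (1 + t * Real.exp B) := mul_le_mul_of_nonneg_left h4 (by positivity)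
      _ = _ := by rw [ht]; ring
  have hg := gam_le p hp
  have hg4 : gam p ≤ 4 := by
    have : 6/(p:ℝ) ≤ 3 := by rw [div_le_iff₀ hp0]; linarith
    linarith
  calc gam p * ∑ e ∈ Finset.Icc 1 N, r^e ≤ gam p * (r + 3*r^2) := mul_le_mul_of_nonneg_left hgeo (gam_nonneg p)
    _ = gam p * r + gam p * (3 * r^2) := by ring
    _ ≤ (1 + 6/p) * r + 4 * (3 * r^2) := by gcongr
    _ = r + 6 * (1/p * r) + 12 * r^2 := by ring
    _ ≤ _ := by linarith

theorem m4 (B : ℝ) (hB : 0 ≤ B) : ∃ C : ℝ, 0 < C ∧ ∀ x : ℝ, 3 ≤ x → ∀ Y β : ℝ, 1 ≤ Y → Y ≤ x → 0 ≤ β → β ≤ 1/4 →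
    β * Real.log Y ≤ B → ∀ N : ℕ,
    ∑ p ∈ (⌊Y⌋₊+1).primesBelow, ∑ e ∈ Finset.Icc 1 N, gg (p^e) * ((p^e:ℕ):ℝ)^(β-1) ≤ Real.log (Real.log x) + C := by
  obtain ⟨C3, hC3, h3⟩ := m3
  have hs : Summable (fun n : ℕ => (n:ℝ)^(-(3/2):ℝ)) := Real.summable_nat_rpow.2 (by norm_num)
  set S := ∑' n : ℕ, (n:ℝ)^(-(3/2):ℝ) with hS
  have hS0 : 0 ≤ S := tsum_nonneg fun _ => by positivity
  refine ⟨C3 + 2 * B * Real.exp B + 18 * S, by positivity, ?_⟩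
  intro x hx Y β hY hYx hβ hβ4 hBY N
  have hY0 : 0 ≤ Y := by linarith
  have hM1 : 1 ≤ ⌊Y⌋₊ := Nat.le_floor (by push_cast; linarith)
  have hMY : (⌊Y⌋₊:ℝ) ≤ Y := Nat.floor_le hY0
  calc _ ≤ ∑ p ∈ (⌊Y⌋₊+1).primesBelow, (1/(p:ℝ) + β * Real.exp B * (Real.log p / p) + 18 * (p:ℝ)^(-(3/2):ℝ)) := by
        apply Finset.sum_le_sum; intro p hp
        obtain ⟨h1, h2⟩ := Nat.mem_primesBelow.1 hp
        apply m4_term B β hβ hβ4 p h2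
        refine le_trans (mul_le_mul_of_nonneg_left ?_ hβ) hBY
        apply Real.log_le_log (by exact_mod_cast h2.pos)
        exact le_trans (by exact_mod_cast (by omega : p ≤ ⌊Y⌋₊)) hMY
    _ = ∑ p ∈ (⌊Y⌋₊+1).primesBelow, 1/(p:ℝ) + β * Real.exp B * ∑ p ∈ (⌊Y⌋₊+1).primesBelow, Real.log p / p + 18 * ∑ p ∈ (⌊Y⌋₊+1).primesBelow, (p:ℝ)^(-(3/2):ℝ) := by
        rw [Finset.sum_add_distrib, Finset.sum_add_distrib, Finset.mul_sum, Finset.mul_sum]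
    _ ≤ (Real.log (Real.log x) + C3) + (2 * B * Real.exp B) + 18 * S := by
        have k1 : ∑ p ∈ (⌊Y⌋₊+1).primesBelow, 1/(p:ℝ) ≤ Real.log (Real.log x) + C3 := by
          refine le_trans (Finset.sum_le_sum_of_subset_of_nonneg ?_ (fun _ _ _ => by positivity)) (h3 x hx)
          intro p hp
          rw [Nat.mem_primesBelow] at hp ⊢
          have := Nat.floor_le_floor hYx
          exact ⟨by omega, hp.2⟩
        have k2 : β * Real.exp B * ∑ p ∈ (⌊Y⌋₊+1).primesBelow, Real.log p / p ≤ 2 * B * Real.exp B := by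
          have h4 := m1 _ hM1
          have h5 : Real.log ⌊Y⌋₊ ≤ Real.log Y := Real.log_le_log (by exact_mod_cast hM1) hMY
          have h6 : ∑ p ∈ (⌊Y⌋₊+1).primesBelow, Real.log p / p ≤ 2 * Real.log Y := by linarith
          calc β * Real.exp B * ∑ p ∈ (⌊Y⌋₊+1).primesBelow, Real.log p / p ≤ β * Real.exp B * (2 * Real.log Y) := by gcongr
            _ = 2 * (β * Real.log Y) * Real.exp B := by ring
            _ ≤ _ := by gcongr
        have k3 : ∑ p ∈ (⌊Y⌋₊+1).primesBelow, (p:ℝ)^(-(3/2):ℝ) ≤ S :=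
          hs.sum_le_tsum _ (fun _ _ => by positivity)
        linarith
    _ = _ := by ring

theorem moeb_inner (l m : ℕ) (hm : Squarefree m) (P : ℕ) (hP : P ≠ 0) (hmP : m ∣ P) :
    ∑ d ∈ P.divisors, (if l ∣ d ∧ d ∣ m then ((ArithmeticFunction.moebius d : ℤ) : ℝ) else 0) =
      if m = l then ((ArithmeticFunction.moebius l : ℤ) : ℝ) else 0 := by
  have hm0 : m ≠ 0 := hm.ne_zero
  by_cases hlm : l ∣ m
  · obtain ⟨k, rfl⟩ := hlm
    have hl0 : l ≠ 0 := by rintro rfl; simp at hm0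
    have hk0 : k ≠ 0 := by rintro rfl; simp at hm0
    rw [← Finset.sum_filter]
    have hset : P.divisors.filter (fun d => l ∣ d ∧ d ∣ l * k) = k.divisors.image (fun e => l * e) := by
      ext d
      simp only [Finset.mem_filter, Nat.mem_divisors, Finset.mem_image]
      constructor
      · rintro ⟨⟨h1, _⟩, ⟨e, rfl⟩, h3⟩
        exact ⟨e, ⟨Nat.dvd_of_mul_dvd_mul_left (Nat.pos_of_ne_zero hl0) h3, hk0⟩, rfl⟩
      · rintro ⟨e, ⟨h1, _⟩, rfl⟩
        exact ⟨⟨(mul_dvd_mul_left l h1).trans hmP, hP⟩, dvd_mul_right _ _, mul_dvd_mul_left l h1⟩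
    rw [hset, Finset.sum_image (fun a _ b _ h => Nat.eq_of_mul_eq_mul_left (Nat.pos_of_ne_zero hl0) h)]
    have hcop : Nat.Coprime l k := Nat.coprime_of_squarefree_mul hm
    have : ∀ e ∈ k.divisors, ((ArithmeticFunction.moebius (l * e) : ℤ) : ℝ) = ((ArithmeticFunction.moebius l : ℤ) : ℝ) * ((ArithmeticFunction.moebius e : ℤ) : ℝ) := by
      intro e he
      rw [ArithmeticFunction.isMultiplicative_moebius.map_mul_of_coprime (hcop.coprime_dvd_right (Nat.dvd_of_mem_divisors he))]
      push_cast; rfl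
    rw [Finset.sum_congr rfl this, ← Finset.mul_sum, ← Int.cast_sum]
    have h2 : ∑ e ∈ k.divisors, ArithmeticFunction.moebius e = if k = 1 then 1 else 0 := by
      rw [← ArithmeticFunction.coe_mul_zeta_apply, ArithmeticFunction.moebius_mul_coe_zeta, ArithmeticFunction.one_apply]
    rw [h2]
    by_cases hk : k = 1
    · simp [hk]
    · have : l * k ≠ l := by
        intro h; apply hk
        have : l * k = l * 1 := by simpa using h
        exact Nat.eq_of_mul_eq_mul_left (Nat.pos_of_ne_zero hl0) this
      simp [hk, this]
  · rw [if_neg (by rintro rfl; exact hlm dvd_rfl)]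
    apply Finset.sum_eq_zero
    intro d _
    rw [if_neg]
    rintro ⟨h1, h2⟩; exact hlm (h1.trans h2)

noncomputable def selG (s : BoundingSieve) (D : ℕ) : ℝ :=
  ∑ l ∈ s.prodPrimes.divisors.filter (fun l => l ≤ D), s.selbergTerms l

noncomputable def selW (s : BoundingSieve) (D : ℕ) (d : ℕ) : ℝ :=
  ((ArithmeticFunction.moebius d : ℤ) : ℝ) * (s.nu d)⁻¹ * (selG s D)⁻¹ *
    ∑ m ∈ s.prodPrimes.divisors.filter (fun m => m ≤ D), if d ∣ m then s.selbergTerms m else 0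

theorem selG_pos (s : BoundingSieve) (D : ℕ) (hD : 1 ≤ D) : 0 < selG s D := by
  unfold selG
  apply Finset.sum_pos
  · intro l hl
    exact BoundingSieve.selbergTerms_pos (Nat.dvd_of_mem_divisors (Finset.mem_filter.1 hl).1)
  · exact ⟨1, by simp [BoundingSieve.prodPrimes_ne_zero, hD]⟩

theorem selW_one (s : BoundingSieve) (D : ℕ) (hD : 1 ≤ D) : selW s D 1 = 1 := by
  have := selG_pos s D hD
  unfold selW
  rw [s.nu_mult.map_one]
  simp only [one_dvd, if_true, ArithmeticFunction.moebius_apply_one]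
  change _ * (selG s D)⁻¹ * selG s D = 1
  field_simp; simp

theorem selW_main (s : BoundingSieve) (D : ℕ) (hD : 1 ≤ D) :
    s.mainSum (BoundingSieve.lambdaSquared (selW s D)) = (selG s D)⁻¹ := by
  have hG := selG_pos s D hD
  have key : ∀ l ∈ s.prodPrimes.divisors, (∑ d ∈ s.prodPrimes.divisors, if l ∣ d then s.nu d * selW s D d else 0) =
      if l ≤ D then ((ArithmeticFunction.moebius l : ℤ) : ℝ) * s.selbergTerms l * (selG s D)⁻¹ else 0 := by
    intro l hl
    calc _ = ∑ d ∈ s.prodPrimes.divisors, ∑ m ∈ s.prodPrimes.divisors.filter (fun m => m ≤ D),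
            (selG s D)⁻¹ * s.selbergTerms m * (if l ∣ d ∧ d ∣ m then ((ArithmeticFunction.moebius d : ℤ) : ℝ) else 0) := by
          apply Finset.sum_congr rfl
          intro d hd
          have hnu := BoundingSieve.nu_ne_zero (s := s) (Nat.dvd_of_mem_divisors hd)
          by_cases hld : l ∣ d
          · simp only [hld, if_true, true_and]
            unfold selW
            rw [Finset.mul_sum, Finset.mul_sum]
            apply Finset.sum_congr rfl
            intro m _
            split_ifs
            · field_simp
            · simp
          · simp [hld]
      _ = ∑ m ∈ s.prodPrimes.divisors.filter (fun m => m ≤ D), (selG s D)⁻¹ * s.selbergTerms m *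
            (if m = l then ((ArithmeticFunction.moebius l : ℤ) : ℝ) else 0) := by
          rw [Finset.sum_comm]
          apply Finset.sum_congr rfl
          intro m hm
          rw [← Finset.mul_sum]
          have hmP := Nat.dvd_of_mem_divisors (Finset.mem_filter.1 hm).1
          rw [moeb_inner l m (BoundingSieve.squarefree_of_dvd_prodPrimes hmP) _ BoundingSieve.prodPrimes_ne_zero hmP]
      _ = _ := by
          simp only [mul_ite, mul_zero]
          rw [Finset.sum_ite_eq']
          simp only [Finset.mem_filter, hl, true_and]
          split_ifs
          · ring
          · rfl
  rw [BoundingSieve.mainSum_lambdaSquared_eq_sum_mul_sum_sq]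
  have : ∀ l ∈ s.prodPrimes.divisors, (s.selbergTerms l)⁻¹ * (∑ d ∈ s.prodPrimes.divisors, if l ∣ d then s.nu d * selW s D d else 0)^2
      = if l ≤ D then s.selbergTerms l * ((selG s D)⁻¹)^2 else 0 := by
    intro l hl
    rw [key l hl]
    have hlP := Nat.dvd_of_mem_divisors hl
    have hg := BoundingSieve.selbergTerms_pos (s := s) hlP
    have hmu : (((ArithmeticFunction.moebius l : ℤ) : ℝ))^2 = 1 := by
      have := ArithmeticFunction.moebius_sq_eq_one_of_squarefree (BoundingSieve.squarefree_of_dvd_prodPrimes (s := s) hlP)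
      exact_mod_cast this
    split_ifs
    · rw [mul_pow, mul_pow, hmu]; field_simp
    · simp
  rw [Finset.sum_congr rfl this, ← Finset.sum_filter, ← Finset.sum_mul]
  change selG s D * _ = _
  field_simp

theorem selW_le (s : BoundingSieve) (D : ℕ) (hD : 1 ≤ D) (hnu : ∀ d, d ∣ s.prodPrimes → 1 ≤ s.nu d * d)
    (d : ℕ) (hd : d ∣ s.prodPrimes) : |selW s D d| ≤ if d ≤ D then (D:ℝ) else 0 := by
  have hG := selG_pos s D hD
  have hnn : ∀ m ∈ s.prodPrimes.divisors.filter (fun m => m ≤ D), 0 ≤ s.selbergTerms m := fun m hm =>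
    (BoundingSieve.selbergTerms_pos (s := s) (Nat.dvd_of_mem_divisors (Finset.mem_filter.1 hm).1)).le
  split_ifs with hdD
  · have hsum : ∑ m ∈ s.prodPrimes.divisors.filter (fun m => m ≤ D), (if d ∣ m then s.selbergTerms m else 0) ≤ selG s D := by
      apply Finset.sum_le_sum
      intro m hm
      split_ifs
      · rfl
      · exact hnn m hm
    have hsum0 : 0 ≤ ∑ m ∈ s.prodPrimes.divisors.filter (fun m => m ≤ D), (if d ∣ m then s.selbergTerms m else 0) := by
      apply Finset.sum_nonneg
      intro m hm
      split_ifs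
      · exact hnn m hm
      · rfl
    have hnup := BoundingSieve.nu_pos_of_dvd_prodPrimes (s := s) hd
    unfold selW
    rw [abs_mul, abs_mul, abs_mul, abs_of_nonneg hsum0, abs_of_pos (inv_pos.2 hG), abs_of_pos (inv_pos.2 hnup)]
    have hmu : |((ArithmeticFunction.moebius d : ℤ) : ℝ)| ≤ 1 := by
      have := ArithmeticFunction.abs_moebius_le_one (n := d)
      exact_mod_cast this
    have h1 : (selG s D)⁻¹ * ∑ m ∈ s.prodPrimes.divisors.filter (fun m => m ≤ D), (if d ∣ m then s.selbergTerms m else 0) ≤ 1 := by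
      rw [inv_mul_le_iff₀ hG]; linarith
    have h2 : (s.nu d)⁻¹ ≤ D := by
      rw [inv_le_iff_one_le_mul₀ hnup]
      have := hnu d hd
      have h3 : (d:ℝ) ≤ D := by exact_mod_cast hdD
      nlinarith
    rw [mul_assoc]
    calc _ ≤ (1 * (D:ℝ)) * 1 := by
          apply mul_le_mul _ h1 _ (by positivity)
          · exact mul_le_mul hmu h2 (inv_nonneg.2 hnup.le) zero_le_one
          · exact mul_nonneg (inv_nonneg.2 hG.le) hsum0
      _ = D := by ring
  · have : selW s D d = 0 := by
      unfold selW
      rw [Finset.sum_eq_zero, mul_zero]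
      intro m hm
      rw [Finset.mem_filter, Nat.mem_divisors] at hm
      rw [if_neg]
      intro h
      have : m ≠ 0 := by rintro rfl; exact hm.1.2 (by simpa using hm.1.1)
      exact hdD (le_trans (Nat.le_of_dvd (Nat.pos_of_ne_zero this) h) hm.2)
    rw [this]; simp

theorem sel_err (s : BoundingSieve) (D : ℕ) (hD : 1 ≤ D) (hnu : ∀ d, d ∣ s.prodPrimes → 1 ≤ s.nu d * d)
    (hrem : ∀ d, d ∣ s.prodPrimes → |s.rem d| ≤ d) :
    s.errSum (BoundingSieve.lambdaSquared (selW s D)) ≤ (D:ℝ)^8 := by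
  have hD0 : (0:ℝ) ≤ D := by positivity
  have hl : ∀ d ∈ s.prodPrimes.divisors, |BoundingSieve.lambdaSquared (selW s D) d| * |s.rem d| ≤ if d ≤ D^2 then (D:ℝ)^6 else 0 := by
    intro d hd
    have hdP := Nat.dvd_of_mem_divisors hd
    have hd0 : d ≠ 0 := by rintro rfl; exact BoundingSieve.prodPrimes_ne_zero (s := s) (by simpa using hdP)
    have hterm : ∀ d1 ∈ d.divisors, ∀ d2 ∈ d.divisors, |if d = Nat.lcm d1 d2 then selW s D d1 * selW s D d2 else 0| ≤
        if d ≤ D^2 then (if d1 ≤ D then (D:ℝ) else 0) * (if d2 ≤ D then (D:ℝ) else 0) else 0 := by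
      intro d1 h1 d2 h2
      have k1 := selW_le s D hD hnu d1 ((Nat.dvd_of_mem_divisors h1).trans hdP)
      have k2 := selW_le s D hD hnu d2 ((Nat.dvd_of_mem_divisors h2).trans hdP)
      by_cases hd12 : d = Nat.lcm d1 d2
      · rw [if_pos hd12, abs_mul]
        have k3 : |selW s D d1| * |selW s D d2| ≤ (if d1 ≤ D then (D:ℝ) else 0) * (if d2 ≤ D then (D:ℝ) else 0) :=
          mul_le_mul k1 k2 (abs_nonneg _) (by split_ifs <;> simp)
        by_cases hdd : d ≤ D^2
        · rw [if_pos hdd]; exact k3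
        · rw [if_neg hdd]
          refine k3.trans ?_
          have : Nat.lcm d1 d2 ≤ d1 * d2 := Nat.le_of_dvd (Nat.mul_pos (Nat.pos_of_mem_divisors h1) (Nat.pos_of_mem_divisors h2)) (Nat.lcm_dvd_mul d1 d2)
          by_cases e1 : d1 ≤ D
          · by_cases e2 : d2 ≤ D
            · exfalso; apply hdd; rw [hd12]
              calc _ ≤ d1 * d2 := this
                _ ≤ D * D := Nat.mul_le_mul e1 e2
                _ = _ := by ring
            · simp [e2]
          · simp [e1]
      · rw [if_neg hd12]; simp only [abs_zero]; split_ifs <;> positivity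
    have hsum : |BoundingSieve.lambdaSquared (selW s D) d| ≤ if d ≤ D^2 then (D:ℝ)^4 else 0 := by
      unfold BoundingSieve.lambdaSquared
      calc _ ≤ ∑ d1 ∈ d.divisors, ∑ d2 ∈ d.divisors, |if d = Nat.lcm d1 d2 then selW s D d1 * selW s D d2 else 0| := by
            refine (Finset.abs_sum_le_sum_abs _ _).trans (Finset.sum_le_sum fun d1 _ => Finset.abs_sum_le_sum_abs _ _)
        _ ≤ ∑ d1 ∈ d.divisors, ∑ d2 ∈ d.divisors, if d ≤ D^2 then (if d1 ≤ D then (D:ℝ) else 0) * (if d2 ≤ D then (D:ℝ) else 0) else 0 :=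
            Finset.sum_le_sum fun d1 h1 => Finset.sum_le_sum fun d2 h2 => hterm d1 h1 d2 h2
        _ ≤ _ := by
          split_ifs with hdd
          · rw [← Finset.sum_mul_sum]
            have : ∑ d1 ∈ d.divisors, (if d1 ≤ D then (D:ℝ) else 0) ≤ D^2 := by
              rw [← Finset.sum_filter, Finset.sum_const, nsmul_eq_mul]
              have : (d.divisors.filter (fun d1 => d1 ≤ D)).card ≤ D := by
                have : d.divisors.filter (fun d1 => d1 ≤ D) ⊆ Finset.Icc 1 D := by
                  intro e he
                  rw [Finset.mem_filter] at he
                  exact Finset.mem_Icc.2 ⟨Nat.pos_of_mem_divisors he.1, he.2⟩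
                simpa using Finset.card_le_card this
              have : ((d.divisors.filter (fun d1 => d1 ≤ D)).card : ℝ) ≤ D := by exact_mod_cast this
              nlinarith
            have h0 : 0 ≤ ∑ d1 ∈ d.divisors, (if d1 ≤ D then (D:ℝ) else 0) := Finset.sum_nonneg fun _ _ => by split_ifs <;> simp
            calc _ ≤ (D:ℝ)^2 * (D:ℝ)^2 := mul_le_mul this this h0 (by positivity)
              _ = _ := by ring
          · simp
    have hr := hrem d hdP
    split_ifs at hsum ⊢ with hdd
    · have : (d:ℝ) ≤ (D:ℝ)^2 := by exact_mod_cast hdd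
      calc _ ≤ (D:ℝ)^4 * (D:ℝ)^2 := mul_le_mul hsum (hr.trans this) (abs_nonneg _) (by positivity)
        _ = _ := by ring
    · have : |BoundingSieve.lambdaSquared (selW s D) d| = 0 := le_antisymm hsum (abs_nonneg _)
      rw [this]; simp
  unfold BoundingSieve.errSum
  refine (Finset.sum_le_sum hl).trans ?_
  rw [← Finset.sum_filter, Finset.sum_const, nsmul_eq_mul]
  have : (s.prodPrimes.divisors.filter (fun d1 => d1 ≤ D^2)).card ≤ D^2 := by
    have : s.prodPrimes.divisors.filter (fun d1 => d1 ≤ D^2) ⊆ Finset.Icc 1 (D^2) := by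
      intro e he
      rw [Finset.mem_filter] at he
      exact Finset.mem_Icc.2 ⟨Nat.pos_of_mem_divisors he.1, he.2⟩
    simpa using Finset.card_le_card this
  have : ((s.prodPrimes.divisors.filter (fun d1 => d1 ≤ D^2)).card : ℝ) ≤ (D:ℝ)^2 := by exact_mod_cast this
  calc _ ≤ (D:ℝ)^2 * (D:ℝ)^6 := by gcongr
    _ = _ := by ring

theorem sel_bound (s : BoundingSieve) (D : ℕ) (hD : 1 ≤ D) (hnu : ∀ d, d ∣ s.prodPrimes → 1 ≤ s.nu d * d)
    (hrem : ∀ d, d ∣ s.prodPrimes → |s.rem d| ≤ d) :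
    s.siftedSum ≤ s.totalMass * (selG s D)⁻¹ + (D:ℝ)^8 := by
  have h1 := BoundingSieve.siftedSum_le_mainSum_errSum_of_upperMoebius (s := s) _
    (BoundingSieve.upperMoebius_lambdaSquared (selW s D) (selW_one s D hD))
  rw [selW_main s D hD] at h1
  linarith [sel_err s D hD hnu hrem]

noncomputable def powAF (β : ℝ) : ArithmeticFunction ℝ := ⟨fun n => if n = 0 then 0 else (n:ℝ)^β, by simp⟩

theorem powAF_apply (β : ℝ) (n : ℕ) (hn : n ≠ 0) : powAF β n = (n:ℝ)^β := by
  simp [powAF, hn]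

theorem powAF_mult (β : ℝ) : (powAF β).IsMultiplicative := by
  rw [ArithmeticFunction.IsMultiplicative.iff_ne_zero]
  refine ⟨by rw [powAF_apply _ _ one_ne_zero]; simp, ?_⟩
  intro m n hm hn _
  rw [powAF_apply _ _ hm, powAF_apply _ _ hn, powAF_apply _ _ (mul_ne_zero hm hn)]
  push_cast
  rw [Real.mul_rpow (by positivity) (by positivity)]

theorem selG_lb (s : BoundingSieve) (z : ℕ) (hz : 2 ≤ z)
    (hP : ∀ p ∈ s.prodPrimes.primeFactors, 3 ≤ p ∧ p ≤ z)
    (hnu : ∀ p ∈ s.prodPrimes.primeFactors, s.nu p = 2 / p) :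
    2⁻¹ * ∏ p ∈ s.prodPrimes.primeFactors, (1 - 2/(p:ℝ))⁻¹ ≤ selG s (z^12) := by
  set P := s.prodPrimes with hPdef
  have hz1 : (1:ℝ) < z := by exact_mod_cast hz
  have hz0 : (0:ℝ) < z := by linarith
  have hlz : 0 < Real.log z := Real.log_pos hz1
  set β := (Real.log z)⁻¹ with hβ
  have hβ0 : 0 < β := inv_pos.2 hlz
  have hsq := s.prodPrimes_squarefree
  have hg : ∀ p ∈ P.primeFactors, 1 + s.selbergTerms p = (1 - 2/(p:ℝ))⁻¹ := by
    intro p hp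
    have hpp := Nat.prime_of_mem_primeFactors hp
    rw [BoundingSieve.selbergTerms_apply, hpp.primeFactors, Finset.prod_singleton, hnu p hp]
    have h3 : (3:ℝ) ≤ p := by exact_mod_cast (hP p hp).1
    have : (1 - 2/(p:ℝ)) ≠ 0 := by
      have : 2/(p:ℝ) < 1 := by rw [div_lt_one (by linarith)]; linarith
      linarith
    linear_combination -inv_mul_cancel₀ this
  set F := ∏ p ∈ P.primeFactors, (1 - 2/(p:ℝ))⁻¹ with hF
  have hF0 : 0 ≤ F := by
    apply Finset.prod_nonneg
    intro p hp
    have h3 : (3:ℝ) ≤ p := by exact_mod_cast (hP p hp).1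
    have : 2/(p:ℝ) < 1 := by rw [div_lt_one (by linarith)]; linarith
    exact inv_nonneg.2 (by linarith)
  have htot : ∑ l ∈ P.divisors, s.selbergTerms l = F := by
    rw [← BoundingSieve.selbergTerms_isMultiplicative.prodPrimeFactors_one_add_of_squarefree hsq]
    exact Finset.prod_congr rfl hg
  have htail : ∑ l ∈ P.divisors.filter (fun l => ¬ l ≤ z^12), s.selbergTerms l ≤ F / 2 := by
    have h1 : ∑ l ∈ P.divisors.filter (fun l => ¬ l ≤ z^12), s.selbergTerms l ≤
        Real.exp (-12) * ∑ l ∈ P.divisors, (s.selbergTerms.pmul (powAF β)) l := by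
      rw [Finset.mul_sum, Finset.sum_filter]
      apply Finset.sum_le_sum
      intro l hl
      have hl0 : l ≠ 0 := (Nat.pos_of_mem_divisors hl).ne'
      have hgl := BoundingSieve.selbergTerms_pos (s := s) (Nat.dvd_of_mem_divisors hl)
      rw [ArithmeticFunction.pmul_apply, powAF_apply _ _ hl0]
      split_ifs with h
      · positivity
      · have h2 : (z:ℝ)^12 ≤ l := by
          push Not at h
          exact_mod_cast h.le
        have h3 : Real.exp 12 ≤ (l:ℝ)^β := by
          calc Real.exp 12 = ((z:ℝ)^12)^β := by
                rw [← Real.rpow_natCast, ← Real.rpow_mul hz0.le, Real.rpow_def_of_pos hz0]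
                congr 1; push_cast; rw [hβ]; field_simp
            _ ≤ _ := Real.rpow_le_rpow (by positivity) h2 hβ0.le
        have h4 : Real.exp (-12) * Real.exp 12 = 1 := by rw [← Real.exp_add]; simp
        have h5 : 1 ≤ Real.exp (-12) * (l:ℝ)^β := by
          rw [← h4]; gcongr
        nlinarith
    have h2 : ∑ l ∈ P.divisors, (s.selbergTerms.pmul (powAF β)) l = ∏ p ∈ P.primeFactors, (1 + s.selbergTerms p * (p:ℝ)^β) := by
      rw [← (BoundingSieve.selbergTerms_isMultiplicative.pmul (powAF_mult β)).prodPrimeFactors_one_add_of_squarefree hsq]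
      apply Finset.prod_congr rfl
      intro p hp
      rw [ArithmeticFunction.pmul_apply, powAF_apply _ _ (Nat.prime_of_mem_primeFactors hp).ne_zero]
    have h3 : ∏ p ∈ P.primeFactors, (1 + s.selbergTerms p * (p:ℝ)^β) ≤
        ∏ p ∈ P.primeFactors, ((1 - 2/(p:ℝ))⁻¹ * Real.exp (2 * Real.exp 1 * β * (Real.log p / p))) := by
      apply Finset.prod_le_prod
      · intro p hp
        have := BoundingSieve.selbergTerms_pos (s := s) (Nat.dvd_of_mem_primeFactors hp)
        positivity
      · intro p hp
        have h3 : (3:ℝ) ≤ p := by exact_mod_cast (hP p hp).1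
        have hp0 : (0:ℝ) < p := by linarith
        have hpz : (p:ℝ) ≤ z := by exact_mod_cast (hP p hp).2
        have h2p : 0 < 1 - 2/(p:ℝ) := by
          have : 2/(p:ℝ) < 1 := by rw [div_lt_one (by linarith)]; linarith
          linarith
        have hgp := hg p hp
        have e1 : s.selbergTerms p = (1 - 2/(p:ℝ))⁻¹ * (2/p) := by
          have : s.selbergTerms p = (1 - 2/(p:ℝ))⁻¹ - 1 := by linarith
          rw [this]; linear_combination inv_mul_cancel₀ h2p.ne'
        set t := β * Real.log p with ht
        have ht0 : 0 ≤ t := mul_nonneg hβ0.le (Real.log_nonneg (by linarith))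
        have ht1 : t ≤ 1 := by
          rw [ht, hβ, inv_mul_le_iff₀ hlz, mul_one]; exact Real.log_le_log hp0 hpz
        have e2 : (p:ℝ)^β = Real.exp t := by rw [Real.rpow_def_of_pos hp0, mul_comm]
        have e3 : Real.exp t ≤ 1 + t * Real.exp 1 := by
          have := Real.add_one_le_exp (-t)
          have h3 : Real.exp (-t) * Real.exp t = 1 := by rw [← Real.exp_add]; simp
          have h4 : Real.exp t ≤ Real.exp 1 := Real.exp_le_exp.2 ht1
          nlinarith [Real.exp_pos t]
        have e4 : 1 + s.selbergTerms p * (p:ℝ)^β = (1 - 2/(p:ℝ))⁻¹ * (1 + 2/p * (Real.exp t - 1)) := by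
          rw [e2, e1]; linear_combination -inv_mul_cancel₀ h2p.ne'
        rw [e4]
        apply mul_le_mul_of_nonneg_left _ (inv_nonneg.2 h2p.le)
        have e5 : 2 * Real.exp 1 * β * (Real.log p / p) = 2/p * (t * Real.exp 1) := by rw [ht]; ring
        rw [e5]
        have e6 : 2/(p:ℝ) * (Real.exp t - 1) ≤ 2/p * (t * Real.exp 1) :=
          mul_le_mul_of_nonneg_left (by linarith) (by positivity)
        linarith [Real.add_one_le_exp (2/(p:ℝ) * (t * Real.exp 1))]
    rw [Finset.prod_mul_distrib, ← Real.exp_sum, ← Finset.mul_sum] at h3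
    have h4 : ∑ p ∈ P.primeFactors, Real.log p / p ≤ 2 * Real.log z := by
      refine le_trans (Finset.sum_le_sum_of_subset_of_nonneg ?_ ?_) (m1 z (by omega))
      · intro p hp
        rw [Nat.mem_primesBelow]
        exact ⟨by have := (hP p hp).2; omega, Nat.prime_of_mem_primeFactors hp⟩
      · intro p _ _; exact div_nonneg (Real.log_natCast_nonneg p) (by positivity)
    have h5 : Real.exp (-12) * Real.exp (2 * Real.exp 1 * β * ∑ p ∈ P.primeFactors, Real.log p / p) ≤ 1/2 := by
      rw [← Real.exp_add]
      have h6 : 2 * Real.exp 1 * β * ∑ p ∈ P.primeFactors, Real.log p / p ≤ 4 * Real.exp 1 := by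
        calc _ ≤ 2 * Real.exp 1 * β * (2 * Real.log z) := by gcongr
          _ = 4 * Real.exp 1 * (β * Real.log z) := by ring
          _ = _ := by rw [hβ, inv_mul_cancel₀ hlz.ne']; ring
      have h7 := Real.exp_one_lt_d9
      calc _ ≤ Real.exp (-1) := Real.exp_le_exp.2 (by linarith)
        _ ≤ 1/2 := by
          rw [Real.exp_neg, inv_le_comm₀ (Real.exp_pos _) (by norm_num)]
          have := Real.add_one_le_exp 1
          linarith
    calc _ ≤ Real.exp (-12) * (F * Real.exp (2 * Real.exp 1 * β * ∑ p ∈ P.primeFactors, Real.log p / p)) := by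
          refine h1.trans ?_
          rw [h2]; gcongr
      _ = F * (Real.exp (-12) * Real.exp (2 * Real.exp 1 * β * ∑ p ∈ P.primeFactors, Real.log p / p)) := by ring
      _ ≤ F * (1/2) := by gcongr
      _ = _ := by ring
  have hsplit := Finset.sum_filter_add_sum_filter_not P.divisors (fun l => l ≤ z^12) (fun l => s.selbergTerms l)
  rw [htot] at hsplit
  have : selG s (z^12) = ∑ l ∈ P.divisors.filter (fun l => l ≤ z^12), s.selbergTerms l := rfl
  rw [this]
  linarith

theorem cnt_mod (N1 N2 r v : ℕ) (h : N1 ≤ N2) (hr : 0 < r) :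
    |(((Finset.Ioc N1 N2).filter (fun n => n ≡ v [MOD r])).card : ℝ) - ((N2:ℝ) - N1) / r| ≤ 1 := by
  have h1 := Nat.Ioc_filter_modEq_card N1 N2 hr v
  have hrr : (0:ℚ) < r := by exact_mod_cast hr
  have key : |(((Finset.Ioc N1 N2).filter (fun n => n ≡ v [MOD r])).card : ℚ) - ((N2:ℚ) - N1) / r| ≤ 1 := by
    have hle : ((N1:ℚ) - v)/r ≤ ((N2:ℚ) - v)/r := by gcongr
    rw [max_eq_left (by have := Int.floor_le_floor hle; linarith)] at h1
    have h2 : (((Finset.Ioc N1 N2).filter (fun n => n ≡ v [MOD r])).card : ℚ) = ((⌊((N2:ℚ) - v)/r⌋ - ⌊((N1:ℚ) - v)/r⌋ : ℤ) : ℚ) := by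
      rw [← h1]; simp
    rw [h2]
    push_cast
    have a1 := Int.floor_le (((N2:ℚ) - v)/r)
    have a2 := Int.lt_floor_add_one (((N2:ℚ) - v)/r)
    have a3 := Int.floor_le (((N1:ℚ) - v)/r)
    have a4 := Int.lt_floor_add_one (((N1:ℚ) - v)/r)
    have a5 : ((N2:ℚ) - N1)/r = ((N2:ℚ) - v)/r - ((N1:ℚ) - v)/r := by ring
    rw [a5, abs_le]
    constructor <;> linarith
  have := (Rat.cast_le (K := ℝ)).2 key
  push_cast at this
  exact this

theorem dvd_split (d b n : ℕ) (hd : d ≠ 0) (hdb : Nat.Coprime d b) :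
    ∑ d1 ∈ d.divisors, (if d1 ∣ n ∧ d / d1 ∣ n + b then (1:ℝ) else 0) = if d ∣ n * (n+b) then 1 else 0 := by
  set g := Nat.gcd d n with hg
  have hg0 : 0 < g := Nat.gcd_pos_of_pos_left _ (Nat.pos_of_ne_zero hd)
  have hgd : g ∣ d := Nat.gcd_dvd_left _ _
  have hgn : g ∣ n := Nat.gcd_dvd_right _ _
  have huniq : ∀ d1 ∈ d.divisors, (d1 ∣ n ∧ d / d1 ∣ n + b) → d1 = g := by
    intro d1 hd1 ⟨h1, h2⟩
    have hd1d := Nat.dvd_of_mem_divisors hd1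
    apply Nat.dvd_antisymm (Nat.dvd_gcd hd1d h1)
    have hc : Nat.Coprime n (d/d1) := by
      apply Nat.Coprime.symm
      rw [Nat.coprime_iff_gcd_eq_one]
      have a1 : Nat.gcd (d/d1) n ∣ n := Nat.gcd_dvd_right _ _
      have a2 : Nat.gcd (d/d1) n ∣ d/d1 := Nat.gcd_dvd_left _ _
      have a3 : Nat.gcd (d/d1) n ∣ b := (Nat.dvd_add_right a1).1 (a2.trans h2)
      have a4 : Nat.gcd (d/d1) n ∣ d := a2.trans (Nat.div_dvd_of_dvd hd1d)
      exact Nat.dvd_one.1 (hdb ▸ Nat.dvd_gcd a4 a3)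
    have hc2 : Nat.Coprime g (d/d1) := hc.coprime_dvd_left hgn
    apply hc2.dvd_of_dvd_mul_right
    rw [Nat.mul_div_cancel' hd1d]; exact hgd
  by_cases hdn : d ∣ n * (n+b)
  · rw [if_pos hdn, Finset.sum_eq_single g]
    · rw [if_pos]
      refine ⟨hgn, ?_⟩
      have hc : Nat.Coprime (d/g) (n/g) := Nat.coprime_div_gcd_div_gcd hg0
      apply hc.dvd_of_dvd_mul_left
      obtain ⟨u, hu⟩ := hgd
      obtain ⟨w, hw⟩ := hgn
      have e1 : d / g = u := by rw [hu]; exact Nat.mul_div_cancel_left _ hg0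
      have e2 : n / g = w := by nth_rw 1 [hw]; exact Nat.mul_div_cancel_left _ hg0
      rw [e1, e2]
      apply Nat.dvd_of_mul_dvd_mul_left hg0
      rw [← hu, ← mul_assoc, ← hw]; exact hdn
    · intro d1 hd1 hne
      rw [if_neg]; intro h; exact hne (huniq d1 hd1 h)
    · intro h; exact absurd (Nat.mem_divisors.2 ⟨hgd, hd⟩) h
  · rw [if_neg hdn]
    apply Finset.sum_eq_zero
    intro d1 hd1
    rw [if_neg]
    rintro ⟨h1, h2⟩
    apply hdn
    rw [← Nat.mul_div_cancel' (Nat.dvd_of_mem_divisors hd1)]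
    exact mul_dvd_mul h1 h2

theorem cnt_d1 (N1 N2 m n0 b d1 d2 : ℕ) (h : N1 ≤ N2) (hm : 0 < m) (h1 : 0 < d1) (h2 : 0 < d2)
    (hc : Nat.Coprime d1 d2) (hcm : Nat.Coprime m (d1*d2)) :
    |(((Finset.Ioc N1 N2).filter (fun n => n ≡ n0 [MOD m] ∧ d1 ∣ n ∧ d2 ∣ n + b)).card : ℝ) - ((N2:ℝ) - N1) / (m * (d1*d2))| ≤ 1 := by
  obtain ⟨r1, hr1, hr2⟩ := Nat.chineseRemainder hc 0 ((d2-1)*b)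
  obtain ⟨r, hr3, hr4⟩ := Nat.chineseRemainder hcm n0 r1
  have hset : (Finset.Ioc N1 N2).filter (fun n => n ≡ n0 [MOD m] ∧ d1 ∣ n ∧ d2 ∣ n + b) =
      (Finset.Ioc N1 N2).filter (fun n => n ≡ r [MOD (m * (d1*d2))]) := by
    apply Finset.filter_congr
    intro n _
    rw [← Nat.modEq_and_modEq_iff_modEq_mul hcm]
    have e1 : n ≡ r [MOD m] ↔ n ≡ n0 [MOD m] := ⟨fun h => h.trans hr3, fun h => h.trans hr3.symm⟩
    have e2 : n ≡ r [MOD d1*d2] ↔ n ≡ r1 [MOD d1*d2] := ⟨fun h => h.trans hr4, fun h => h.trans hr4.symm⟩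
    rw [e1, e2, ← Nat.modEq_and_modEq_iff_modEq_mul hc]
    have e3 : n ≡ r1 [MOD d1] ↔ d1 ∣ n := by
      rw [← Nat.modEq_zero_iff_dvd]
      exact ⟨fun h => h.trans hr1, fun h => h.trans hr1.symm⟩
    have e5 : (d2-1)*b + b ≡ 0 [MOD d2] := by
      rw [Nat.modEq_zero_iff_dvd]
      refine ⟨b, ?_⟩
      obtain ⟨k, rfl⟩ : ∃ k, d2 = k+1 := ⟨d2-1, by omega⟩
      simp; ring
    have e4 : n ≡ r1 [MOD d2] ↔ d2 ∣ n + b := by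
      rw [← Nat.modEq_zero_iff_dvd]
      constructor
      · intro h
        exact ((h.trans hr2).add_right b).trans e5
      · intro h
        exact (Nat.ModEq.add_right_cancel' b (h.trans e5.symm)).trans hr2.symm
    rw [e3, e4]
  rw [hset]
  have := cnt_mod N1 N2 (m * (d1*d2)) r h (by positivity)
  push_cast at this
  exact this

noncomputable def tauAF : ArithmeticFunction ℝ := ⟨fun d => (d.divisors.card : ℝ) / d, by simp⟩

theorem tauAF_apply (d : ℕ) : tauAF d = (d.divisors.card : ℝ) / d := rfl

theorem tauAF_mult : tauAF.IsMultiplicative := by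
  rw [ArithmeticFunction.IsMultiplicative.iff_ne_zero]
  refine ⟨by simp [tauAF_apply], ?_⟩
  intro m n hm hn h
  rw [tauAF_apply, tauAF_apply, tauAF_apply, h.card_divisors_mul]
  push_cast
  ring

theorem tauAF_prime (p : ℕ) (hp : p.Prime) : tauAF p = 2 / p := by
  rw [tauAF_apply, hp.divisors, Finset.card_pair hp.one_lt.ne]; norm_num

noncomputable def mySieve (N1 N2 m n0 b : ℕ) (S : Finset ℕ) (hS : ∀ p ∈ S, p.Prime ∧ 3 ≤ p) : BoundingSieve where
  support := ((Finset.Ioc N1 N2).filter (fun n => n ≡ n0 [MOD m])).image (fun n => n * (n+b))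
  prodPrimes := ∏ p ∈ S, p
  prodPrimes_squarefree := by
    apply Finset.squarefree_prod_of_pairwise_isCoprime
    · intro p hp q hq hpq
      exact Nat.coprime_iff_isRelPrime.1 ((Nat.coprime_primes (hS p hp).1 (hS q hq).1).2 hpq)
    · intro p hp; exact (hS p hp).1.prime.squarefree
  weights := fun _ => 1
  weights_nonneg := fun _ => zero_le_one
  totalMass := ((N2:ℝ) - N1) / m
  nu := tauAF
  nu_mult := tauAF_mult
  nu_pos_of_prime := by
    intro p hp _
    have := hp.pos
    rw [tauAF_prime p hp]; positivity
  nu_lt_one_of_prime := by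
    intro p hp h
    rw [tauAF_prime p hp]
    obtain ⟨q, hq, hpq⟩ := (hp.prime.dvd_finset_prod_iff _).1 h
    have := (Nat.prime_dvd_prime_iff_eq hp (hS q hq).1).1 hpq
    have h3 : (3:ℝ) ≤ p := by rw [this]; exact_mod_cast (hS q hq).2
    rw [div_lt_one (by linarith)]; linarith

theorem sieve1 (N1 N2 m n0 b z : ℕ) (S : Finset ℕ) (hS : ∀ p ∈ S, p.Prime ∧ 3 ≤ p) (hN : N1 ≤ N2)
    (hm : 0 < m) (hb : 1 ≤ b) (hz : 2 ≤ z) (hSz : ∀ p ∈ S, p ≤ z) (hSm : ∀ p ∈ S, ¬ p ∣ m) (hSb : ∀ p ∈ S, ¬ p ∣ b) :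
    (((Finset.Ioc N1 N2).filter (fun n => n ≡ n0 [MOD m] ∧ ∀ p ∈ S, ¬ p ∣ n * (n+b))).card : ℝ) ≤
      2 * (((N2:ℝ) - N1) / m) * ∏ p ∈ S, (1 - 2/(p:ℝ)) + (z:ℝ)^96 := by
  set s := mySieve N1 N2 m n0 b S hS with hs
  have hP : s.prodPrimes = ∏ p ∈ S, p := rfl
  have hPF : s.prodPrimes.primeFactors = S := Nat.primeFactors_prod (fun p hp => (hS p hp).1)
  have hinj : Set.InjOn (fun n : ℕ => n * (n+b)) ((Finset.Ioc N1 N2).filter (fun n => n ≡ n0 [MOD m])) := by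
    intro u _ v _ h
    dsimp at h
    rcases lt_trichotomy u v with h1 | h1 | h1
    · have := Nat.mul_lt_mul'' h1 (show u + b < v + b by omega); omega
    · exact h1
    · have := Nat.mul_lt_mul'' h1 (show v + b < u + b by omega); omega
  have hsift : s.siftedSum = (((Finset.Ioc N1 N2).filter (fun n => n ≡ n0 [MOD m] ∧ ∀ p ∈ S, ¬ p ∣ n * (n+b))).card : ℝ) := by
    unfold BoundingSieve.siftedSum
    have e : s.support = ((Finset.Ioc N1 N2).filter (fun n => n ≡ n0 [MOD m])).image (fun n => n * (n+b)) := rfl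
    rw [e, Finset.sum_image hinj, ← Finset.filter_filter, Finset.card_filter]
    push_cast
    apply Finset.sum_congr rfl
    intro n _
    have hw : s.weights (n * (n+b)) = 1 := rfl
    rw [hw]
    have : Nat.Coprime s.prodPrimes (n * (n+b)) ↔ ∀ p ∈ S, ¬ p ∣ n * (n+b) := by
      rw [hP, Nat.Coprime, ← Nat.coprime_iff_gcd_eq_one, Nat.coprime_prod_left_iff]
      exact forall₂_congr fun p hp => (hS p hp).1.coprime_iff_not_dvd
    simp only [this]
  have hcop : ∀ d, d ∣ s.prodPrimes → ∀ k : ℕ, (∀ p ∈ S, ¬ p ∣ k) → Nat.Coprime d k := by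
    intro d hd k hk
    apply Nat.Coprime.coprime_dvd_left hd
    rw [hP, Nat.coprime_prod_left_iff]
    exact fun p hp => (hS p hp).1.coprime_iff_not_dvd.2 (hk p hp)
  have hrem : ∀ d, d ∣ s.prodPrimes → |s.rem d| ≤ d := by
    intro d hd
    have hd0 : d ≠ 0 := by rintro rfl; exact BoundingSieve.prodPrimes_ne_zero (s := s) (by simpa using hd)
    have hdsq := BoundingSieve.squarefree_of_dvd_prodPrimes hd
    have hmul : s.multSum d = ∑ d1 ∈ d.divisors, (((Finset.Ioc N1 N2).filter (fun n => n ≡ n0 [MOD m] ∧ d1 ∣ n ∧ d/d1 ∣ n + b)).card : ℝ) := by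
      unfold BoundingSieve.multSum
      have e : s.support = ((Finset.Ioc N1 N2).filter (fun n => n ≡ n0 [MOD m])).image (fun n => n * (n+b)) := rfl
      rw [e, Finset.sum_image hinj]
      have e2 : ∀ d1 ∈ d.divisors, (((Finset.Ioc N1 N2).filter (fun n => n ≡ n0 [MOD m] ∧ d1 ∣ n ∧ d/d1 ∣ n + b)).card : ℝ) =
          ∑ n ∈ (Finset.Ioc N1 N2).filter (fun n => n ≡ n0 [MOD m]), if d1 ∣ n ∧ d/d1 ∣ n + b then (1:ℝ) else 0 := by
        intro d1 _
        rw [← Finset.filter_filter, Finset.card_filter]; push_cast; rfl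
      rw [Finset.sum_congr rfl e2, Finset.sum_comm]
      apply Finset.sum_congr rfl
      intro n _
      rw [dvd_split d b n hd0 (hcop d hd b hSb)]
      rfl
    have hnu : s.nu d * s.totalMass = ∑ d1 ∈ d.divisors, ((N2:ℝ) - N1) / (m * d) := by
      have e1 : s.nu d = (d.divisors.card : ℝ) / d := rfl
      have e2 : s.totalMass = ((N2:ℝ) - N1) / m := rfl
      rw [e1, e2, Finset.sum_const, nsmul_eq_mul]
      have : (d:ℝ) ≠ 0 := by exact_mod_cast hd0
      have : (m:ℝ) ≠ 0 := by exact_mod_cast hm.ne'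
      field_simp
    unfold BoundingSieve.rem
    rw [hmul, hnu, ← Finset.sum_sub_distrib]
    refine (Finset.abs_sum_le_sum_abs _ _).trans ?_
    calc _ ≤ ∑ d1 ∈ d.divisors, (1:ℝ) := by
          apply Finset.sum_le_sum
          intro d1 hd1
          have hd1d := Nat.dvd_of_mem_divisors hd1
          have hdd : d1 * (d/d1) = d := Nat.mul_div_cancel' hd1d
          have h1 : 0 < d1 := Nat.pos_of_mem_divisors hd1
          have h2 : 0 < d/d1 := Nat.pos_of_ne_zero (by intro h; rw [h] at hdd; omega)
          have := cnt_d1 N1 N2 m n0 b d1 (d/d1) hN hm h1 h2 (by apply Nat.coprime_of_squarefree_mul; rw [hdd]; exact hdsq)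
            (by rw [hdd]; exact (hcop d hd m hSm).symm)
          have e : ((d1:ℝ) * ((d/d1 : ℕ):ℝ)) = d := by exact_mod_cast hdd
          rw [e] at this
          exact this
      _ = (d.divisors.card : ℝ) := by simp
      _ ≤ d := by exact_mod_cast Nat.card_divisors_le_self d
  have hnu1 : ∀ d, d ∣ s.prodPrimes → 1 ≤ s.nu d * d := by
    intro d hd
    have hd0 : d ≠ 0 := by rintro rfl; exact BoundingSieve.prodPrimes_ne_zero (s := s) (by simpa using hd)
    have e1 : s.nu d = (d.divisors.card : ℝ) / d := rfl
    have : (d:ℝ) ≠ 0 := by exact_mod_cast hd0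
    rw [e1, div_mul_cancel₀ _ this]
    have : 1 ≤ d.divisors.card := Finset.card_pos.2 ⟨1, by simp [hd0]⟩
    exact_mod_cast this
  have hmain := sel_bound s (z^12) (Nat.one_le_pow _ _ (by omega)) hnu1 hrem
  rw [hsift] at hmain
  have hlb := selG_lb s z hz (fun p hp => by rw [hPF] at hp; exact ⟨(hS p hp).2, hSz p hp⟩)
    (fun p hp => tauAF_prime p (Nat.prime_of_mem_primeFactors hp))
  rw [hPF] at hlb
  have hF : ∀ p ∈ S, 0 < 1 - 2/(p:ℝ) := by
    intro p hp
    have h3 : (3:ℝ) ≤ p := by exact_mod_cast (hS p hp).2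
    have : 2/(p:ℝ) < 1 := by rw [div_lt_one (by linarith)]; linarith
    linarith
  have hF0 : 0 < ∏ p ∈ S, (1 - 2/(p:ℝ)) := Finset.prod_pos hF
  rw [Finset.prod_inv_distrib] at hlb
  have hG : (selG s (z^12))⁻¹ ≤ 2 * ∏ p ∈ S, (1 - 2/(p:ℝ)) := by
    rw [← mul_inv] at hlb
    exact inv_le_of_inv_le₀ (by positivity) hlb
  have ht : s.totalMass = ((N2:ℝ) - N1) / m := rfl
  have ht0 : 0 ≤ ((N2:ℝ) - N1) / m := by
    apply div_nonneg _ (by positivity)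
    have : (N1:ℝ) ≤ N2 := by exact_mod_cast hN
    linarith
  rw [ht] at hmain
  have e96 : (((z^12 : ℕ)):ℝ)^8 = (z:ℝ)^96 := by push_cast; ring
  rw [e96] at hmain
  have := mul_le_mul_of_nonneg_left hG ht0
  linarith

theorem gam_one_le (p : ℕ) (hp : p.Prime) : 1 ≤ gam p := by
  have hp2 : (2:ℝ) ≤ p := by exact_mod_cast hp.two_le
  have h : 0 < 1 - 1/(p:ℝ) := by
    have : 1/(p:ℝ) < 1 := by rw [div_lt_one (by linarith)]; linarith
    linarith
  have h1 : 1 ≤ (1 - 1/(p:ℝ))⁻¹ := by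
    rw [one_le_inv₀ h]
    have : 0 ≤ 1/(p:ℝ) := by positivity
    linarith
  unfold gam
  exact one_le_pow₀ h1

theorem gg_mul_le (a b : ℕ) (ha : a ≠ 0) (hb : b ≠ 0) : gg (a*b) ≤ gg a * gg b := by
  unfold gg
  rw [Nat.primeFactors_mul ha hb, ← Finset.prod_union_inter]
  apply le_mul_of_one_le_right (Finset.prod_nonneg fun p _ => gam_nonneg p)
  have : ∏ p ∈ a.primeFactors ∩ b.primeFactors, (1:ℝ) ≤ ∏ p ∈ a.primeFactors ∩ b.primeFactors, gam p := by
    apply Finset.prod_le_prod (fun _ _ => zero_le_one)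
    intro p hp
    exact gam_one_le p (Nat.prime_of_mem_primeFactors (Finset.mem_inter.1 hp).1)
  simpa using this

theorem prodS_le (z k : ℕ) (hz : 2 ≤ z) (hk : k ≠ 0) (hk2 : 2 ∣ k) :
    ∏ p ∈ (z+1).primesBelow.filter (fun p => ¬ p ∣ k), (1 - 2/(p:ℝ)) ≤ gg k / (Real.log z)^2 := by
  have hz1 : (1:ℝ) < z := by exact_mod_cast hz
  have hlz : 0 < Real.log z := Real.log_pos hz1
  have hpos : ∀ p ∈ (z+1).primesBelow, 0 < 1 - 1/(p:ℝ) := by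
    intro p hp
    have hp2 : (2:ℝ) ≤ p := by exact_mod_cast (Nat.mem_primesBelow.1 hp).2.two_le
    have : 1/(p:ℝ) < 1 := by rw [div_lt_one (by linarith)]; linarith
    linarith
  have h1 : ∏ p ∈ (z+1).primesBelow.filter (fun p => ¬ p ∣ k), (1 - 2/(p:ℝ)) ≤
      ∏ p ∈ (z+1).primesBelow.filter (fun p => ¬ p ∣ k), (1 - 1/(p:ℝ))^2 := by
    apply Finset.prod_le_prod
    · intro p hp
      rw [Finset.mem_filter, Nat.mem_primesBelow] at hp
      have hp2 : (2:ℝ) ≤ p := by exact_mod_cast hp.1.2.two_le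
      have : 2/(p:ℝ) ≤ 1 := by rw [div_le_one (by linarith)]; linarith
      linarith
    · intro p hp
      have : (1 - 1/(p:ℝ))^2 = 1 - 2/p + (1/(p:ℝ))^2 := by ring
      rw [this]
      have : 0 ≤ (1/(p:ℝ))^2 := by positivity
      linarith
  have h2 := Finset.prod_filter_mul_prod_filter_not (z+1).primesBelow (fun p => p ∣ k) (fun p => (1 - 1/(p:ℝ))^2)
  set A := ∏ p ∈ (z+1).primesBelow.filter (fun p => p ∣ k), (1 - 1/(p:ℝ))^2 with hA
  set B := ∏ p ∈ (z+1).primesBelow.filter (fun p => ¬ p ∣ k), (1 - 1/(p:ℝ))^2 with hB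
  have hA0 : 0 < A := Finset.prod_pos fun p hp => by have := hpos p (Finset.mem_filter.1 hp).1; positivity
  have hm2 := m2 z (by omega)
  rw [Finset.prod_inv_distrib] at hm2
  rw [Finset.prod_pow] at h2
  set W := ∏ p ∈ (z+1).primesBelow, (1 - 1/(p:ℝ)) with hW
  have hW0 : 0 < W := Finset.prod_pos hpos
  have hWl : W ≤ (Real.log z)⁻¹ := le_inv_of_le_inv₀ hlz hm2
  have hAinv : A⁻¹ ≤ gg k := by
    rw [hA, ← Finset.prod_inv_distrib]
    unfold gg
    have : ∀ p ∈ (z+1).primesBelow.filter (fun p => p ∣ k), ((1 - 1/(p:ℝ))^2)⁻¹ = gam p := by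
      intro p _; unfold gam; rw [inv_pow]
    rw [Finset.prod_congr rfl this]
    have hsub : (z+1).primesBelow.filter (fun p => p ∣ k) ⊆ k.primeFactors := by
      intro p hp
      rw [Finset.mem_filter, Nat.mem_primesBelow] at hp
      exact Nat.mem_primeFactors.2 ⟨hp.1.2, hp.2, hk⟩
    rw [← Finset.prod_sdiff hsub]
    apply le_mul_of_one_le_left (Finset.prod_nonneg fun p _ => gam_nonneg p)
    have : ∏ p ∈ k.primeFactors \ (z+1).primesBelow.filter (fun p => p ∣ k), (1:ℝ) ≤ ∏ p ∈ k.primeFactors \ (z+1).primesBelow.filter (fun p => p ∣ k), gam p := by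
      apply Finset.prod_le_prod (fun _ _ => zero_le_one)
      intro p hp
      exact gam_one_le p (Nat.prime_of_mem_primeFactors (Finset.mem_sdiff.1 hp).1)
    simpa using this
  have hBeq : B = W^2 * A⁻¹ := by field_simp; linarith
  refine h1.trans ?_
  rw [hBeq]
  calc W^2 * A⁻¹ ≤ ((Real.log z)⁻¹)^2 * gg k := by gcongr
    _ = _ := by rw [inv_pow]; field_simp

theorem sieve2 (b : ℕ) (hb : 1 ≤ b) : ∃ C : ℝ, 0 < C ∧ ∀ N1 N2 a1 a2 z : ℕ, N1 ≤ N2 → 1 ≤ a1 → 1 ≤ a2 → 2 ≤ z →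
    (((Finset.Ioc N1 N2).filter (fun n => a1 ∣ n ∧ a2 ∣ n + b ∧ ∀ p : ℕ, p.Prime → p ≤ z → ¬ p ∣ a1 * a2 → ¬ p ∣ n * (n+b))).card : ℝ) ≤
      C * ((N2:ℝ) - N1) / (Real.log z)^2 * (gg a1 / a1 * (gg a2 / a2)) + (z:ℝ)^96 := by
  have hg0 : 0 ≤ gg (2*b) := gg_nonneg _
  refine ⟨2 * b * (gg (2*b) + 1), by positivity, ?_⟩
  intro N1 N2 a1 a2 z hN ha1 ha2 hz
  have hz1 : (1:ℝ) < z := by exact_mod_cast hz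
  have hlz : 0 < Real.log z := Real.log_pos hz1
  have hNN : 0 ≤ (N2:ℝ) - N1 := by
    have : (N1:ℝ) ≤ N2 := by exact_mod_cast hN
    linarith
  have hg1 := gg_nonneg a1
  have hg2 := gg_nonneg a2
  set T := (Finset.Ioc N1 N2).filter (fun n => a1 ∣ n ∧ a2 ∣ n + b ∧ ∀ p : ℕ, p.Prime → p ≤ z → ¬ p ∣ a1 * a2 → ¬ p ∣ n * (n+b)) with hT
  rcases T.eq_empty_or_nonempty with he | ⟨n0, hn0⟩
  · rw [he]; simp only [Finset.card_empty, Nat.cast_zero]; positivity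
  · rw [hT, Finset.mem_filter] at hn0
    obtain ⟨_, hn1, hn2, _⟩ := hn0
    set k := 2 * b * (a1 * a2) with hk
    have hk0 : k ≠ 0 := by positivity
    set m := Nat.lcm a1 a2 with hm
    have hm0 : 0 < m := Nat.lcm_pos ha1 ha2
    set S := (z+1).primesBelow.filter (fun p => ¬ p ∣ k) with hS
    have hSP : ∀ p ∈ S, p.Prime ∧ p ≤ z ∧ ¬ p ∣ k := by
      intro p hp
      rw [hS, Finset.mem_filter, Nat.mem_primesBelow] at hp
      exact ⟨hp.1.2, by omega, hp.2⟩
    have hS3 : ∀ p ∈ S, p.Prime ∧ 3 ≤ p := by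
      intro p hp
      obtain ⟨h1, h2, h3⟩ := hSP p hp
      refine ⟨h1, ?_⟩
      have := h1.two_le
      rcases this.lt_or_eq with h | h
      · exact h
      · exfalso; apply h3; rw [← h, hk, mul_assoc]; exact dvd_mul_right _ _
    have hs := sieve1 N1 N2 m n0 b z S hS3 hN hm0 hb hz (fun p hp => (hSP p hp).2.1)
      (fun p hp h => (hSP p hp).2.2 ((h.trans (Nat.lcm_dvd_mul a1 a2)).trans (dvd_mul_left _ _)))
      (fun p hp h => (hSP p hp).2.2 ((h.trans (dvd_mul_left _ _)).trans (dvd_mul_right _ _)))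
    have hsub : T ⊆ (Finset.Ioc N1 N2).filter (fun n => n ≡ n0 [MOD m] ∧ ∀ p ∈ S, ¬ p ∣ n * (n+b)) := by
      intro n hn
      rw [hT, Finset.mem_filter] at hn
      rw [Finset.mem_filter]
      obtain ⟨h1, h2, h3, h4⟩ := hn
      refine ⟨h1, ?_, ?_⟩
      · apply Nat.mod_lcm
        · exact ((Nat.modEq_zero_iff_dvd).2 h2).trans ((Nat.modEq_zero_iff_dvd).2 hn1).symm
        · exact Nat.ModEq.add_right_cancel' b (((Nat.modEq_zero_iff_dvd).2 h3).trans ((Nat.modEq_zero_iff_dvd).2 hn2).symm)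
      · intro p hp
        obtain ⟨k1, k2, k3⟩ := hSP p hp
        exact h4 p k1 k2 (fun h => k3 (h.trans (dvd_mul_left _ _)))
    have hcard : (T.card : ℝ) ≤ _ := (Nat.cast_le.2 (Finset.card_le_card hsub)).trans hs
    refine hcard.trans ?_
    have hprod := prodS_le z k hz hk0 (by rw [hk, mul_assoc]; exact dvd_mul_right _ _)
    have hgk : gg k ≤ (gg (2*b) + 1) * (gg a1 * gg a2) := by
      have e1 : gg k ≤ gg (2*b) * gg (a1*a2) := gg_mul_le _ _ (by positivity) (by positivity)
      have e2 : gg (a1*a2) ≤ gg a1 * gg a2 := gg_mul_le _ _ (by positivity) (by positivity)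
      have e3 : gg (2*b) * gg (a1*a2) ≤ (gg (2*b) + 1) * (gg a1 * gg a2) :=
        mul_le_mul (by linarith) e2 (gg_nonneg _) (by positivity)
      linarith
    have hmge : (a1:ℝ) * a2 ≤ b * m := by
      have e1 : Nat.gcd a1 a2 * m = a1 * a2 := Nat.gcd_mul_lcm a1 a2
      have e2 : Nat.gcd a1 a2 ∣ b := (Nat.dvd_add_right ((Nat.gcd_dvd_left a1 a2).trans hn1)).1 ((Nat.gcd_dvd_right a1 a2).trans hn2)
      have e3 : Nat.gcd a1 a2 ≤ b := Nat.le_of_dvd hb e2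
      have : a1 * a2 ≤ b * m := by rw [← e1]; exact Nat.mul_le_mul_right _ e3
      exact_mod_cast this
    have ha1' : (0:ℝ) < a1 := by exact_mod_cast ha1
    have ha2' : (0:ℝ) < a2 := by exact_mod_cast ha2
    have hm0' : (0:ℝ) < m := by exact_mod_cast hm0
    have hdiv : ((N2:ℝ) - N1)/m ≤ b * ((N2:ℝ) - N1) / (a1 * a2) := by
      rw [div_le_div_iff₀ hm0' (by positivity)]
      nlinarith
    have hP0 : 0 ≤ ∏ p ∈ S, (1 - 2/(p:ℝ)) := by
      apply Finset.prod_nonneg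
      intro p hp
      have h3 : (3:ℝ) ≤ p := by exact_mod_cast (hS3 p hp).2
      have : 2/(p:ℝ) < 1 := by rw [div_lt_one (by linarith)]; linarith
      linarith
    have : 2 * (((N2:ℝ) - N1)/m) * ∏ p ∈ S, (1 - 2/(p:ℝ)) ≤
        2 * (b * ((N2:ℝ) - N1) / (a1 * a2)) * (((gg (2*b) + 1) * (gg a1 * gg a2)) / (Real.log z)^2) := by
      apply mul_le_mul
      · linarith
      · refine hprod.trans ?_; gcongr
      · exact hP0
      · positivity
    have e : 2 * (b * ((N2:ℝ) - N1) / (a1 * a2)) * (((gg (2*b) + 1) * (gg a1 * gg a2)) / (Real.log z)^2) =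
        2 * b * (gg (2*b) + 1) * ((N2:ℝ) - N1) / (Real.log z)^2 * (gg a1 / a1 * (gg a2 / a2)) := by
      field_simp
    linarith

noncomputable def AS (N : ℕ) (Y : ℝ) (j : ℕ) : Finset ℕ :=
  (Finset.Icc 1 N).filter (fun a => a.primeFactors ⊆ (⌊Y⌋₊+1).primesBelow ∧ a.primeFactors.card = j)

theorem loglog_pos (x : ℝ) (hx : 3 ≤ x) : 0 < Real.log (Real.log x) := by
  apply Real.log_pos
  rw [Real.lt_log_iff_exp_lt (by linarith)]
  have := Real.exp_one_lt_d9
  linarith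

theorem AS_sum (B : ℝ) (hB : 0 ≤ B) : ∃ C : ℝ, 0 < C ∧ ∀ x : ℝ, 3 ≤ x → ∀ Y β : ℝ, 1 ≤ Y → Y ≤ x → 0 ≤ β → β ≤ 1/4 →
    β * Real.log Y ≤ B → ∀ N j : ℕ,
    ∑ a ∈ AS N Y j, gg a * (a:ℝ)^(β-1) ≤ (Real.log (Real.log x) + C)^j / (j.factorial : ℝ) := by
  obtain ⟨C, hC, h⟩ := m4 B hB
  refine ⟨C, hC, ?_⟩
  intro x hx Y β h1 h2 h3 h4 h5 N j
  have hb := h x hx Y β h1 h2 h3 h4 h5 N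
  have hf : ∀ n : ℕ, 0 ≤ gg n * (n:ℝ)^(β-1) := fun n => mul_nonneg (gg_nonneg n) (by positivity)
  have := m5 (fun a => gg a * (a:ℝ)^(β-1)) hf (by simp [gg]) (by
    intro a b hab
    rw [gg_mul a b hab, Nat.cast_mul, Real.mul_rpow (by positivity) (by positivity)]; ring) ((⌊Y⌋₊+1).primesBelow) N j
  unfold AS
  refine this.trans ?_
  apply div_le_div_of_nonneg_right _ (by positivity)
  apply pow_le_pow_left₀ _ hb
  exact Finset.sum_nonneg fun p _ => Finset.sum_nonneg fun e _ => hf _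

def Good (b : ℕ) (x H Y : ℝ) (z j1 j2 n a1 a2 : ℕ) : Prop :=
  1 ≤ a1 ∧ 1 ≤ a2 ∧ a1 ∣ n ∧ a2 ∣ n + b ∧ H ≤ (a1:ℝ) * a2 ∧ (a1:ℝ) * a2 ≤ x^((1/4):ℝ) ∧
    a1.primeFactors.card = j1 ∧ a2.primeFactors.card = j2 ∧
    (∀ p : ℕ, p.Prime → p ∣ a1 * a2 → (p:ℝ) ≤ Y) ∧
    (∀ p : ℕ, p.Prime → p ≤ z → ¬ p ∣ a1 * a2 → ¬ p ∣ n * (n+b))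

theorem block (B : ℝ) (hB : 0 ≤ B) (b : ℕ) (hb : 1 ≤ b) : ∃ C : ℝ, 0 < C ∧ ∀ x : ℝ, 3 ≤ x → ∀ N1 N2 z : ℕ, N1 ≤ N2 → 2 ≤ z →
    ∀ Y β H : ℝ, 1 ≤ Y → Y ≤ x → 0 ≤ β → β ≤ 1/4 → β * Real.log Y ≤ B → 0 < H → ∀ j1 j2 : ℕ,
    ∀ W : Finset ℕ, W ⊆ Finset.Ioc N1 N2 → (∀ n ∈ W, ∃ a1 a2, Good b x H Y z j1 j2 n a1 a2) →
    (W.card : ℝ) ≤ C * ((N2:ℝ) - N1) / (Real.log z)^2 * H^(-β) *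
      ((Real.log (Real.log x) + C)^j1 / (j1.factorial : ℝ) * ((Real.log (Real.log x) + C)^j2 / (j2.factorial : ℝ))) +
      x^((1/2):ℝ) * (z:ℝ)^96 := by
  obtain ⟨C1, hC1, hAS⟩ := AS_sum B hB
  obtain ⟨C2, hC2, hsv⟩ := sieve2 b hb
  refine ⟨C1 + C2, by positivity, ?_⟩
  intro x hx N1 N2 z hN hz Y β H hY hYx hβ hβ4 hβY hH j1 j2 W hW hWg
  have hL := loglog_pos x hx
  have hz1 : (1:ℝ) < z := by exact_mod_cast hz
  have hlz : 0 < Real.log z := Real.log_pos hz1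
  have hNN : 0 ≤ (N2:ℝ) - N1 := by
    have : (N1:ℝ) ≤ N2 := by exact_mod_cast hN
    linarith
  have hx0 : 0 ≤ x := by linarith
  set N := ⌊x^((1/4):ℝ)⌋₊ with hNdef
  set PR := (AS N Y j1 ×ˢ AS N Y j2).filter (fun t => H ≤ (t.1:ℝ) * t.2) with hPR
  set T : ℕ × ℕ → Finset ℕ := fun t => (Finset.Ioc N1 N2).filter (fun n => t.1 ∣ n ∧ t.2 ∣ n + b ∧ ∀ p : ℕ, p.Prime → p ≤ z → ¬ p ∣ t.1 * t.2 → ¬ p ∣ n * (n+b)) with hT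
  have hsub : W ⊆ PR.biUnion T := by
    intro n hn
    obtain ⟨a1, a2, h1, h2, h3, h4, h5, h6, h7, h8, h9, h10⟩ := hWg n hn
    rw [Finset.mem_biUnion]
    have ha1 : (1:ℝ) ≤ a1 := by exact_mod_cast h1
    have ha2 : (1:ℝ) ≤ a2 := by exact_mod_cast h2
    refine ⟨(a1, a2), ?_, ?_⟩
    · rw [hPR, Finset.mem_filter, Finset.mem_product]
      refine ⟨⟨?_, ?_⟩, h5⟩
      · simp only [AS, Finset.mem_filter, Finset.mem_Icc]
        refine ⟨⟨h1, Nat.le_floor (by nlinarith)⟩, ?_, h7⟩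
        intro p hp
        rw [Nat.mem_primesBelow]
        have hpp := Nat.prime_of_mem_primeFactors hp
        refine ⟨?_, hpp⟩
        have := Nat.le_floor (h9 p hpp ((Nat.dvd_of_mem_primeFactors hp).trans (dvd_mul_right _ _)))
        omega
      · simp only [AS, Finset.mem_filter, Finset.mem_Icc]
        refine ⟨⟨h2, Nat.le_floor (by nlinarith)⟩, ?_, h8⟩
        intro p hp
        rw [Nat.mem_primesBelow]
        have hpp := Nat.prime_of_mem_primeFactors hp
        refine ⟨?_, hpp⟩
        have := Nat.le_floor (h9 p hpp ((Nat.dvd_of_mem_primeFactors hp).trans (dvd_mul_left _ _)))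
        omega
    · rw [hT, Finset.mem_filter]
      exact ⟨hW hn, h3, h4, h10⟩
  have hc1 : (W.card : ℝ) ≤ ∑ t ∈ PR, ((T t).card : ℝ) := by
    have := (Finset.card_le_card hsub).trans Finset.card_biUnion_le
    exact_mod_cast this
  set K := C2 * ((N2:ℝ) - N1) / (Real.log z)^2 with hK
  have hK0 : 0 ≤ K := by positivity
  have hmemAS : ∀ j a, a ∈ AS N Y j → 1 ≤ a := by
    intro j a ha
    simp only [AS, Finset.mem_filter, Finset.mem_Icc] at ha
    exact ha.1.1
  have hf : ∀ n : ℕ, 0 ≤ gg n * (n:ℝ)^(β-1) := fun n => mul_nonneg (gg_nonneg n) (by positivity)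
  have hterm : ∀ t ∈ PR, ((T t).card : ℝ) ≤ K * H^(-β) * ((gg t.1 * (t.1:ℝ)^(β-1)) * (gg t.2 * (t.2:ℝ)^(β-1))) + (z:ℝ)^96 := by
    intro t ht
    rw [hPR, Finset.mem_filter, Finset.mem_product] at ht
    have h1 := hmemAS _ _ ht.1.1
    have h2 := hmemAS _ _ ht.1.2
    have ha1 : (0:ℝ) < t.1 := by exact_mod_cast h1
    have ha2 : (0:ℝ) < t.2 := by exact_mod_cast h2
    have h3 := hsv N1 N2 t.1 t.2 z hN h1 h2 hz
    refine h3.trans ?_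
    have e1 : gg t.1 / t.1 * (gg t.2 / t.2) ≤ H^(-β) * ((gg t.1 * (t.1:ℝ)^(β-1)) * (gg t.2 * (t.2:ℝ)^(β-1))) := by
      have e2 : (t.1:ℝ)^(β-1) * (t.2:ℝ)^(β-1) = ((t.1:ℝ) * t.2)^β * ((t.1:ℝ) * t.2)⁻¹ := by
        rw [← Real.mul_rpow ha1.le ha2.le, Real.rpow_sub (by positivity), Real.rpow_one]; rfl
      have e3 : 1 ≤ H^(-β) * ((t.1:ℝ) * t.2)^β := by
        rw [Real.rpow_neg hH.le, ← div_eq_inv_mul, one_le_div (by positivity)]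
        exact Real.rpow_le_rpow hH.le ht.2 hβ
      have e4 : H^(-β) * ((gg t.1 * (t.1:ℝ)^(β-1)) * (gg t.2 * (t.2:ℝ)^(β-1))) =
          (gg t.1 / t.1 * (gg t.2 / t.2)) * (H^(-β) * ((t.1:ℝ) * t.2)^β) := by
        calc _ = H^(-β) * (gg t.1 * gg t.2) * ((t.1:ℝ)^(β-1) * (t.2:ℝ)^(β-1)) := by ring
          _ = _ := by rw [e2]; field_simp
      rw [e4]
      apply le_mul_of_one_le_right _ e3
      have := gg_nonneg t.1
      have := gg_nonneg t.2
      positivity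
    have := mul_le_mul_of_nonneg_left e1 hK0
    linarith
  have hsum1 : ∑ t ∈ PR, ((gg t.1 * (t.1:ℝ)^(β-1)) * (gg t.2 * (t.2:ℝ)^(β-1))) ≤
      (Real.log (Real.log x) + C1)^j1 / (j1.factorial : ℝ) * ((Real.log (Real.log x) + C1)^j2 / (j2.factorial : ℝ)) := by
    calc _ ≤ ∑ t ∈ AS N Y j1 ×ˢ AS N Y j2, ((gg t.1 * (t.1:ℝ)^(β-1)) * (gg t.2 * (t.2:ℝ)^(β-1))) :=
          Finset.sum_le_sum_of_subset_of_nonneg (Finset.filter_subset _ _) (fun t _ _ => mul_nonneg (hf _) (hf _))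
      _ = (∑ a ∈ AS N Y j1, gg a * (a:ℝ)^(β-1)) * ∑ a ∈ AS N Y j2, gg a * (a:ℝ)^(β-1) := by
          rw [Finset.sum_product, Finset.sum_mul_sum]
      _ ≤ _ := by
          apply mul_le_mul (hAS x hx Y β hY hYx hβ hβ4 hβY N j1) (hAS x hx Y β hY hYx hβ hβ4 hβY N j2)
          · exact Finset.sum_nonneg fun a _ => hf a
          · positivity
  have hcardPR : (PR.card : ℝ) ≤ x^((1/2):ℝ) := by
    have h1 : PR.card ≤ N * N := by
      refine (Finset.card_filter_le _ _).trans ?_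
      rw [Finset.card_product]
      have : ∀ j, (AS N Y j).card ≤ N := fun j => (Finset.card_filter_le _ _).trans (by simp)
      exact Nat.mul_le_mul (this _) (this _)
    have h2 : (N:ℝ) ≤ x^((1/4):ℝ) := Nat.floor_le (by positivity)
    calc (PR.card : ℝ) ≤ (N:ℝ) * N := by exact_mod_cast h1
      _ ≤ x^((1/4):ℝ) * x^((1/4):ℝ) := by gcongr
      _ = _ := by rw [← Real.rpow_add (by linarith)]; norm_num
  have hH0 : 0 ≤ H^(-β) := by positivity
  calc (W.card : ℝ) ≤ ∑ t ∈ PR, (K * H^(-β) * ((gg t.1 * (t.1:ℝ)^(β-1)) * (gg t.2 * (t.2:ℝ)^(β-1))) + (z:ℝ)^96) :=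
        hc1.trans (Finset.sum_le_sum hterm)
    _ = K * H^(-β) * (∑ t ∈ PR, ((gg t.1 * (t.1:ℝ)^(β-1)) * (gg t.2 * (t.2:ℝ)^(β-1)))) + PR.card * (z:ℝ)^96 := by
        rw [Finset.sum_add_distrib, ← Finset.mul_sum, Finset.sum_const, nsmul_eq_mul]
    _ ≤ ((C1 + C2) * ((N2:ℝ) - N1) / (Real.log z)^2) * H^(-β) *
      ((Real.log (Real.log x) + (C1 + C2))^j1 / (j1.factorial : ℝ) * ((Real.log (Real.log x) + (C1 + C2))^j2 / (j2.factorial : ℝ))) +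
      x^((1/2):ℝ) * (z:ℝ)^96 := by
        have hKle : K ≤ (C1 + C2) * ((N2:ℝ) - N1) / (Real.log z)^2 := by
          rw [hK]; gcongr; linarith
        have hS2 : (Real.log (Real.log x) + C1)^j1 / (j1.factorial : ℝ) * ((Real.log (Real.log x) + C1)^j2 / (j2.factorial : ℝ)) ≤
            (Real.log (Real.log x) + (C1 + C2))^j1 / (j1.factorial : ℝ) * ((Real.log (Real.log x) + (C1 + C2))^j2 / (j2.factorial : ℝ)) := by
          gcongr <;> linarith
        have h3 : K * H^(-β) * (∑ t ∈ PR, ((gg t.1 * (t.1:ℝ)^(β-1)) * (gg t.2 * (t.2:ℝ)^(β-1)))) ≤ _ :=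
          mul_le_mul (mul_le_mul_of_nonneg_right hKle hH0) (hsum1.trans hS2)
            (Finset.sum_nonneg fun t _ => mul_nonneg (hf _) (hf _)) (by positivity)
        have h4 : (PR.card : ℝ) * (z:ℝ)^96 ≤ x^((1/2):ℝ) * (z:ℝ)^96 := by gcongr
        linarith

theorem ratio_lem (R C L : ℝ) (hR : 1 ≤ R) (hC : 0 ≤ C) (hL : 0 < L) (k s : ℕ) (hs : 1 ≤ s) (hsk : s ≤ k)
    (hk : (k:ℝ) ≤ R * L) :
    (L + C)^(k-s) / ((k-s).factorial : ℝ) ≤ Real.exp (C*R) * R^(s-1) * (L^(k-1) / ((k-1).factorial : ℝ)) := by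
  obtain ⟨d, rfl⟩ : ∃ d, s = d + 1 := ⟨s-1, by omega⟩
  obtain ⟨m, rfl⟩ : ∃ m, k = m + (d + 1) := ⟨k - (d+1), by omega⟩
  have e1 : m + (d+1) - (d+1) = m := by omega
  have e2 : m + (d+1) - 1 = m + d := by omega
  have e3 : d + 1 - 1 = d := by omega
  rw [e1, e2, e3]
  push_cast at hk
  have hf : ((m+d).factorial : ℝ) ≤ m.factorial * (R*L)^d := by
    have h1 := Nat.factorial_mul_descFactorial (show d ≤ m + d by omega)
    have h2 := Nat.descFactorial_le_pow (m+d) d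
    rw [show m + d - d = m by omega] at h1
    rw [← h1]
    push_cast
    apply mul_le_mul_of_nonneg_left _ (by positivity)
    calc (((m+d).descFactorial d : ℕ):ℝ) ≤ (((m+d)^d : ℕ) : ℝ) := by exact_mod_cast h2
      _ ≤ (R*L)^d := by
        push_cast
        apply pow_le_pow_left₀ (by positivity)
        linarith
  have hp : (L+C)^m ≤ L^m * Real.exp (C*R) := by
    have h1 : (L + C) = L * (C/L + 1) := by field_simp; ring
    rw [h1, mul_pow]
    apply mul_le_mul_of_nonneg_left _ (by positivity)
    calc (C/L+1)^m ≤ (Real.exp (C/L))^m := pow_le_pow_left₀ (by positivity) (Real.add_one_le_exp _) _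
      _ = Real.exp (m * (C/L)) := by rw [Real.exp_nat_mul]
      _ ≤ _ := by
        apply Real.exp_le_exp.2
        rw [← mul_div_assoc, div_le_iff₀ hL]
        have : (m:ℝ) ≤ R * L := by
          have : (0:ℝ) ≤ d := by positivity
          linarith
        nlinarith
  rw [div_le_iff₀ (by positivity), ← mul_div_assoc, div_mul_eq_mul_div, le_div_iff₀ (by positivity)]
  calc (L+C)^m * ((m+d).factorial:ℝ) ≤ (L^m * Real.exp (C*R)) * (m.factorial * (R*L)^d) := by gcongr
    _ = _ := by rw [mul_pow, pow_add]; ring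

theorem T_lb (R x : ℝ) (hR : 1 ≤ R) (hx : 3 ≤ x) (k : ℕ) (hk : (k:ℝ) ≤ R * Real.log (Real.log x)) :
    (Real.log x)^(-(R * Real.log R)) ≤ (Real.log (Real.log x))^(k-1) / ((k-1).factorial : ℝ) := by
  set L := Real.log (Real.log x) with hLdef
  have hL := loglog_pos x hx
  have hlx : 0 < Real.log x := Real.log_pos (by linarith)
  have hj : ((k-1 : ℕ):ℝ) ≤ R * L := le_trans (by exact_mod_cast Nat.sub_le k 1) hk
  set j := k - 1
  have hf : (j.factorial : ℝ) ≤ R^j * L^j := by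
    rw [← mul_pow]
    calc (j.factorial:ℝ) ≤ ((j^j : ℕ):ℝ) := by exact_mod_cast Nat.factorial_le_pow j
      _ ≤ _ := by push_cast; exact pow_le_pow_left₀ (by positivity) hj _
  have hRj : R^j ≤ (Real.log x)^(R * Real.log R) := by
    rw [Real.rpow_def_of_pos hlx, ← Real.rpow_natCast, Real.rpow_def_of_pos (by linarith)]
    apply Real.exp_le_exp.2
    have := Real.log_nonneg hR
    calc Real.log R * j ≤ Real.log R * (R * L) := by gcongr
      _ = _ := by rw [hLdef]; ring
  rw [Real.rpow_neg hlx.le, le_div_iff₀ (by positivity), inv_mul_le_iff₀ (by positivity)]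
  calc _ ≤ R^j * L^j := hf
    _ ≤ _ := by gcongr

theorem absorb (R θ : ℝ) (hR : 1 ≤ R) (hθ : 0 < θ) (A : ℕ) : ∃ C : ℝ, 0 < C ∧ ∀ x : ℝ, 3 ≤ x → ∀ k1 k2 : ℕ,
    (k1:ℝ) ≤ R * Real.log (Real.log x) → (k2:ℝ) ≤ R * Real.log (Real.log x) →
    (Real.log x)^A * x^(1-θ) ≤ C * (x * ((Real.log (Real.log x))^(k1-1) / ((k1-1).factorial : ℝ)) * ((Real.log (Real.log x))^(k2-1) / ((k2-1).factorial : ℝ)) / (Real.log x)^2) := by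
  set P := R * Real.log R with hP
  have hP0 : 0 ≤ P := mul_nonneg (by linarith) (Real.log_nonneg hR)
  set E : ℝ := A + 2 + 2 * P with hE
  have hE0 : 0 < E := by positivity
  refine ⟨1 / (θ/E)^E, by positivity, ?_⟩
  intro x hx k1 k2 h1 h2
  have hlx : 0 < Real.log x := Real.log_pos (by linarith)
  have t1 := T_lb R x hR hx k1 h1
  have t2 := T_lb R x hR hx k2 h2
  rw [← hP] at t1 t2
  have hx0 : 0 < x := by linarith
  have key : (Real.log x)^E ≤ x^θ / (θ/E)^E := by
    have := Real.log_le_rpow_div hx0.le (show 0 < θ/E by positivity)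
    calc (Real.log x)^E ≤ (x^(θ/E) / (θ/E))^E := Real.rpow_le_rpow hlx.le this hE0.le
      _ = _ := by
        rw [Real.div_rpow (by positivity) (by positivity), ← Real.rpow_mul hx0.le]
        congr 2; field_simp
  have hmul : (Real.log x)^(-P) * (Real.log x)^(-P) ≤ ((Real.log (Real.log x))^(k1-1) / ((k1-1).factorial : ℝ)) * ((Real.log (Real.log x))^(k2-1) / ((k2-1).factorial : ℝ)) := by
    apply mul_le_mul t1 t2 (by positivity)
    exact le_trans (by positivity) t1
  have e : (Real.log x)^A = (Real.log x)^E * ((Real.log x)^(-P) * (Real.log x)^(-P)) / (Real.log x)^2 := by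
    rw [eq_div_iff (by positivity), ← Real.rpow_natCast, ← Real.rpow_natCast, ← Real.rpow_add hlx, ← Real.rpow_add hlx, ← Real.rpow_add hlx]
    congr 1; rw [hE]; push_cast; ring
  rw [e]
  calc _ ≤ (x^θ / (θ/E)^E) * (((Real.log (Real.log x))^(k1-1) / ((k1-1).factorial : ℝ)) * ((Real.log (Real.log x))^(k2-1) / ((k2-1).factorial : ℝ))) / (Real.log x)^2 * x^(1-θ) := by
        gcongr
    _ = _ := by
        have h3 : x^θ * x^(1-θ) = x := by rw [← Real.rpow_add hx0]; simp
        generalize (Real.log (Real.log x))^(k1-1) / ((k1-1).factorial : ℝ) = T1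
        generalize (Real.log (Real.log x))^(k2-1) / ((k2-1).factorial : ℝ) = T2
        generalize (Real.log x)^2 = l2
        generalize (θ/E)^E = e3
        calc _ = 1 / e3 * ((x^θ * x^(1-θ)) * T1 * T2 / l2) := by ring
          _ = _ := by rw [h3]

noncomputable def sm (t n : ℕ) : ℕ := ∏ p ∈ n.primeFactors.filter (· ≤ t), p^(n.factorization p)

theorem sm_prod (n : ℕ) (hn : n ≠ 0) : ∏ p ∈ n.primeFactors, p^(n.factorization p) = n := by
  have := Nat.prod_factorization_pow_eq_self hn
  rwa [Finsupp.prod, Nat.support_factorization] at this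

theorem sm_dvd (t n : ℕ) (hn : n ≠ 0) : sm t n ∣ n := by
  conv_rhs => rw [← sm_prod n hn]
  exact Finset.prod_dvd_prod_of_subset _ _ _ (Finset.filter_subset _ _)

theorem sm_pos (t n : ℕ) : 0 < sm t n := by
  apply Finset.prod_pos
  intro p hp
  exact pow_pos (Nat.pos_of_mem_primeFactors (Finset.mem_filter.1 hp).1) _

theorem sm_prime_dvd (t n p : ℕ) (hn : n ≠ 0) (hp : p.Prime) : p ∣ sm t n ↔ p ≤ t ∧ p ∣ n := by
  constructor
  · intro h
    have h2 := h
    unfold sm at h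
    rw [hp.prime.dvd_finset_prod_iff] at h
    obtain ⟨r, hr, hpr⟩ := h
    obtain ⟨hr1, hr2⟩ := Finset.mem_filter.1 hr
    have := (Nat.prime_dvd_prime_iff_eq hp (Nat.prime_of_mem_primeFactors hr1)).1 (hp.dvd_of_dvd_pow hpr)
    subst this
    exact ⟨hr2, h2.trans (sm_dvd t n hn)⟩
  · rintro ⟨h1, h2⟩
    have hm : p ∈ n.primeFactors.filter (· ≤ t) := Finset.mem_filter.2 ⟨Nat.mem_primeFactors.2 ⟨hp, h2, hn⟩, h1⟩
    have h3 : p ∣ p^(n.factorization p) := dvd_pow_self p (by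
      have := (hp.dvd_iff_one_le_factorization hn).1 h2
      omega)
    exact h3.trans (Finset.dvd_prod_of_mem (fun p => p^(n.factorization p)) hm)

theorem sm_primeFactors (t n : ℕ) (hn : n ≠ 0) : (sm t n).primeFactors = n.primeFactors.filter (· ≤ t) := by
  ext p
  rw [Nat.mem_primeFactors, Finset.mem_filter, Nat.mem_primeFactors]
  constructor
  · rintro ⟨h1, h2, h3⟩
    have := (sm_prime_dvd t n p hn h1).1 h2
    exact ⟨⟨h1, this.2, hn⟩, this.1⟩
  · rintro ⟨⟨h1, h2, h3⟩, h4⟩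
    exact ⟨h1, (sm_prime_dvd t n p hn h1).2 ⟨h4, h2⟩, (sm_pos t n).ne'⟩

theorem sm_zero (n : ℕ) : sm 0 n = 1 := by
  unfold sm
  apply Finset.prod_eq_one
  intro p hp
  obtain ⟨h1, h2⟩ := Finset.mem_filter.1 hp
  have := Nat.pos_of_mem_primeFactors h1
  omega

theorem sm_top (t n : ℕ) (hn : n ≠ 0) (h : n.primeFactors.filter (· ≤ t) = n.primeFactors) : sm t n = n := by
  unfold sm
  rw [h, sm_prod n hn]

theorem sm_self (t n : ℕ) (hn : n ≠ 0) (h : n ≤ t) : sm t n = n := by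
  apply sm_top t n hn
  apply Finset.filter_true_of_mem
  intro p hp
  exact (Nat.le_of_mem_primeFactors hp).trans h

theorem sm_succ (t n : ℕ) : sm (t+1) n = sm t n * (t+1)^(n.factorization (t+1)) := by
  unfold sm
  by_cases h : (t+1) ∈ n.primeFactors
  · have : n.primeFactors.filter (· ≤ t+1) = insert (t+1) (n.primeFactors.filter (· ≤ t)) := by
      ext p
      simp only [Finset.mem_filter, Finset.mem_insert]
      constructor
      · rintro ⟨h1, h2⟩
        by_cases h3 : p = t+1
        · exact Or.inl h3
        · exact Or.inr ⟨h1, by omega⟩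
      · rintro (h1 | ⟨h1, h2⟩)
        · subst h1; exact ⟨h, le_rfl⟩
        · exact ⟨h1, by omega⟩
    rw [this, Finset.prod_insert (by simp), mul_comm]
  · have : n.primeFactors.filter (· ≤ t+1) = (n.primeFactors.filter (· ≤ t)) := by
      ext p
      simp only [Finset.mem_filter]
      constructor
      · rintro ⟨h1, h2⟩
        refine ⟨h1, ?_⟩
        have : p ≠ t+1 := fun h3 => h (h3 ▸ h1)
        omega
      · rintro ⟨h1, h2⟩
        exact ⟨h1, by omega⟩
    rw [this]
    have h0 : n.factorization (t+1) = 0 := by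
      rwa [← Finsupp.notMem_support_iff, Nat.support_factorization]
    rw [h0]; simp

def NExc (X : ℝ) (n : ℕ) : Prop := ∀ p e : ℕ, p.Prime → 2 ≤ e → p^e ∣ n → ((p:ℝ)^e ≤ X)

theorem NExc.pow_le {X : ℝ} {n : ℕ} (hX : 1 ≤ X) (h : NExc X n) (q : ℕ) (hq : q.Prime) :
    ((q:ℝ)^(n.factorization q)) ≤ max (q:ℝ) X := by
  rcases Nat.lt_or_ge (n.factorization q) 2 with h1 | h1
  · have : n.factorization q = 0 ∨ n.factorization q = 1 := by omega
    rcases this with h2 | h2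
    · rw [h2]; simp [hX]
    · rw [h2]; simp
  · exact (h q _ hq h1 (Nat.ordProj_dvd n q)).trans (le_max_right _ _)

theorem sm_le {X : ℝ} {n : ℕ} (hX : 1 ≤ X) (h : NExc X n) (t : ℕ) (ht : (t:ℝ) ≤ X) : (sm t n : ℝ) ≤ X^t := by
  unfold sm
  push_cast
  calc ∏ p ∈ n.primeFactors.filter (· ≤ t), (p:ℝ)^(n.factorization p) ≤ ∏ p ∈ n.primeFactors.filter (· ≤ t), X := by
        apply Finset.prod_le_prod
        · intros; positivity
        · intro p hp
          obtain ⟨h1, h2⟩ := Finset.mem_filter.1 hp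
          refine (h.pow_le hX p (Nat.prime_of_mem_primeFactors h1)).trans ?_
          have : (p:ℝ) ≤ t := by exact_mod_cast h2
          exact max_le (by linarith) le_rfl
    _ = X^(n.primeFactors.filter (· ≤ t)).card := by simp
    _ ≤ X^t := by
        apply pow_le_pow_right₀ hX
        calc (n.primeFactors.filter (· ≤ t)).card ≤ (Finset.Icc 1 t).card := by
              apply Finset.card_le_card
              intro p hp
              obtain ⟨h1, h2⟩ := Finset.mem_filter.1 hp
              exact Finset.mem_Icc.2 ⟨Nat.pos_of_mem_primeFactors h1, h2⟩
          _ = t := by simp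

theorem sm_omega (t n : ℕ) (hn : n ≠ 0) : (sm t n).primeFactors.card ≤ n.primeFactors.card ∧
    (t+1)^(n.primeFactors.card - (sm t n).primeFactors.card) ≤ n ∧
    (sm t n < n → (sm t n).primeFactors.card < n.primeFactors.card) := by
  rw [sm_primeFactors t n hn]
  have hle : (n.primeFactors.filter (· ≤ t)).card ≤ n.primeFactors.card := Finset.card_filter_le _ _
  refine ⟨hle, ?_, ?_⟩
  · have h1 := Finset.card_filter_add_card_filter_not (s := n.primeFactors) (· ≤ t)
    have h2 : n.primeFactors.card - (n.primeFactors.filter (· ≤ t)).card = (n.primeFactors.filter (fun p => ¬ p ≤ t)).card := by omega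
    rw [h2, ← Finset.prod_const]
    calc ∏ p ∈ n.primeFactors.filter (fun p => ¬ p ≤ t), (t+1) ≤ ∏ p ∈ n.primeFactors.filter (fun p => ¬ p ≤ t), p := by
          apply Finset.prod_le_prod'
          intro p hp
          have := (Finset.mem_filter.1 hp).2
          omega
      _ ≤ n := by
          apply Nat.le_of_dvd (Nat.pos_of_ne_zero hn)
          exact (Finset.prod_dvd_prod_of_subset _ _ _ (Finset.filter_subset _ _)).trans (Nat.prod_primeFactors_dvd n)
  · intro hlt
    apply lt_of_le_of_ne hle
    intro h
    have := Finset.eq_of_subset_of_card_le (Finset.filter_subset (· ≤ t) n.primeFactors) h.ge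
    have := sm_top t n hn this
    omega

theorem decomp (n m y0 : ℕ) (X Z : ℝ) (hX : 1 ≤ X) (hZ : 1 ≤ Z) (hn : Z < n) (hm : Z < m) (hy : (y0:ℝ) ≤ X)
    (hXZ : X^(2*y0) ≤ Z) (e1 : NExc X n) (e2 : NExc X m) :
    ∃ q a1 a2 : ℕ, y0 < q ∧ 1 ≤ a1 ∧ 1 ≤ a2 ∧ a1 ∣ n ∧ a2 ∣ m ∧ (a1:ℝ) * a2 ≤ Z ∧
      Z ≤ (a1:ℝ) * a2 * (max (q:ℝ) X)^2 ∧
      (∀ p : ℕ, p.Prime → p ∣ a1 * a2 → p < q) ∧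
      (∀ p : ℕ, p.Prime → p < q → ¬ p ∣ a1 * a2 → ¬ p ∣ n * m) ∧
      a1.primeFactors.card < n.primeFactors.card ∧ a2.primeFactors.card < m.primeFactors.card ∧
      q^(n.primeFactors.card - a1.primeFactors.card) ≤ n ∧ q^(m.primeFactors.card - a2.primeFactors.card) ≤ m := by
  have hn0 : n ≠ 0 := by rintro rfl; simp at hn; linarith
  have hm0 : m ≠ 0 := by rintro rfl; simp at hm; linarith
  have hex : ∃ t : ℕ, Z < (sm t n : ℝ) * sm t m := by
    refine ⟨max n m, ?_⟩
    rw [sm_self _ n hn0 (le_max_left _ _), sm_self _ m hm0 (le_max_right _ _)]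
    nlinarith
  obtain ⟨t, ht⟩ : ∃ t, Nat.find hex = t + 1 := by
    rcases Nat.eq_zero_or_pos (Nat.find hex) with h | h
    · have := Nat.find_spec hex
      rw [h, sm_zero, sm_zero] at this
      norm_num at this; linarith
    · exact ⟨Nat.find hex - 1, by omega⟩
  have hq := Nat.find_spec hex
  rw [ht] at hq
  have hlt : (sm t n : ℝ) * sm t m ≤ Z := by
    have := Nat.find_min hex (show t < Nat.find hex by omega)
    exact not_lt.1 this
  have hs1 : (1:ℝ) ≤ sm t n := by exact_mod_cast sm_pos t n
  have hs2 : (1:ℝ) ≤ sm t m := by exact_mod_cast sm_pos t m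
  have o1 := sm_omega t n hn0
  have o2 := sm_omega t m hm0
  have hprime : (t+1).Prime := by
    by_contra hc
    rw [sm_succ, sm_succ, Nat.factorization_eq_zero_of_not_prime _ hc, Nat.factorization_eq_zero_of_not_prime _ hc] at hq
    simp at hq; linarith
  refine ⟨t+1, sm t n, sm t m, ?_, sm_pos t n, sm_pos t m, sm_dvd t n hn0, sm_dvd t m hm0, hlt, ?_, ?_, ?_, ?_, ?_, o1.2.1, o2.2.1⟩
  · by_contra hc
    have h1 : ((t+1 : ℕ):ℝ) ≤ X := le_trans (by exact_mod_cast not_lt.1 hc) hy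
    have b1 := sm_le hX e1 (t+1) h1
    have b2 := sm_le hX e2 (t+1) h1
    have : (sm (t+1) n : ℝ) * sm (t+1) m ≤ X^(t+1) * X^(t+1) := by gcongr
    rw [← pow_add] at this
    have h3 : X^(t+1+(t+1)) ≤ X^(2*y0) := pow_le_pow_right₀ hX (by omega)
    linarith
  · have p1 := e1.pow_le hX (t+1) hprime
    have p2 := e2.pow_le hX (t+1) hprime
    rw [sm_succ, sm_succ] at hq
    push_cast at hq p1 p2 ⊢
    refine hq.le.trans ?_
    calc _ = (sm t n : ℝ) * sm t m * (((t:ℝ)+1)^(n.factorization (t+1)) * ((t:ℝ)+1)^(m.factorization (t+1))) := by ring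
      _ ≤ (sm t n : ℝ) * sm t m * (max ((t:ℝ)+1) X * max ((t:ℝ)+1) X) := by gcongr
      _ = _ := by ring
  · intro p hp h
    rcases (hp.dvd_mul).1 h with h | h
    · have := ((sm_prime_dvd t n p hn0 hp).1 h).1; omega
    · have := ((sm_prime_dvd t m p hm0 hp).1 h).1; omega
  · intro p hp hpq hnd h
    apply hnd
    rcases (hp.dvd_mul).1 h with h | h
    · exact ((sm_prime_dvd t n p hn0 hp).2 ⟨by omega, h⟩).mul_right _
    · exact ((sm_prime_dvd t m p hm0 hp).2 ⟨by omega, h⟩).mul_left _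
  · apply o1.2.2
    have : (sm t n : ℝ) < n := by nlinarith
    exact_mod_cast this
  · apply o2.2.2
    have : (sm t m : ℝ) < m := by nlinarith
    exact_mod_cast this

theorem exc_card (X : ℝ) (M D : ℕ) (hD : (D:ℝ)^3 ≤ X) :
    (((Finset.Icc 1 M).filter (fun n => ¬ NExc X n)).card : ℝ) ≤ M * (2 / ((D:ℝ)+1)) := by
  have hsub : (Finset.Icc 1 M).filter (fun n => ¬ NExc X n) ⊆
      (Finset.Ioo D (M+1)).biUnion (fun d => (Finset.Ioc 0 M).filter (fun n => d^2 ∣ n)) := by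
    intro n hn
    obtain ⟨h1, h2⟩ := Finset.mem_filter.1 hn
    obtain ⟨h3, h4⟩ := Finset.mem_Icc.1 h1
    unfold NExc at h2
    push Not at h2
    obtain ⟨p, e, hp, he, hdvd, hlt⟩ := h2
    have hd : (p^(e/2))^2 ∣ n := by
      rw [← pow_mul]
      exact (pow_dvd_pow p (by omega)).trans hdvd
    have hpos : 0 < p^(e/2) := pow_pos hp.pos _
    rw [Finset.mem_biUnion]
    refine ⟨p^(e/2), Finset.mem_Ioo.2 ⟨?_, ?_⟩, Finset.mem_filter.2 ⟨Finset.mem_Ioc.2 ⟨by omega, h4⟩, hd⟩⟩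
    · have h5 : p^e ≤ (p^(e/2))^3 := by
        rw [← pow_mul]
        exact Nat.pow_le_pow_right hp.pos (by omega)
      have h6 : ((p:ℝ)^e) ≤ ((p^(e/2) : ℕ):ℝ)^3 := by exact_mod_cast h5
      have h7 : (D:ℝ)^3 < ((p^(e/2) : ℕ):ℝ)^3 := by linarith
      have h8 := lt_of_pow_lt_pow_left₀ 3 (by positivity) h7
      exact_mod_cast h8
    · have := Nat.le_of_dvd (by omega) hd
      have : p^(e/2) ≤ (p^(e/2))^2 := Nat.le_self_pow (by norm_num) _
      omega
  calc (((Finset.Icc 1 M).filter (fun n => ¬ NExc X n)).card : ℝ)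
      ≤ (((Finset.Ioo D (M+1)).biUnion (fun d => (Finset.Ioc 0 M).filter (fun n => d^2 ∣ n))).card : ℝ) := by
        exact_mod_cast Finset.card_le_card hsub
    _ ≤ ∑ d ∈ Finset.Ioo D (M+1), (((Finset.Ioc 0 M).filter (fun n => d^2 ∣ n)).card : ℝ) := by
        exact_mod_cast Finset.card_biUnion_le
    _ ≤ ∑ d ∈ Finset.Ioo D (M+1), (M:ℝ) * ((d:ℝ)^2)⁻¹ := by
        apply Finset.sum_le_sum
        intro d hd
        rw [Nat.Ioc_filter_dvd_card_eq_div]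
        calc ((M / d^2 : ℕ):ℝ) ≤ (M:ℝ) / ((d^2 : ℕ):ℝ) := Nat.cast_div_le
          _ = _ := by push_cast; rw [div_eq_mul_inv]
    _ = M * ∑ d ∈ Finset.Ioo D (M+1), ((d:ℝ)^2)⁻¹ := by rw [Finset.mul_sum]
    _ ≤ _ := by
        apply mul_le_mul_of_nonneg_left (sum_Ioo_inv_sq_le D (M+1)) (by positivity)

theorem exc_bound (b : ℕ) (hb : 1 ≤ b) (x θ : ℝ) (hx : 3 ≤ x) (hbx : (b:ℝ) ≤ x) :
    (((Finset.Ioc ⌊x⌋₊ ⌊2*x⌋₊).filter (fun n => ¬ (NExc (x^θ) n ∧ NExc (x^θ) (n+b)))).card : ℝ) ≤ 12 * x^(1-θ/3) := by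
  have hx0 : 0 < x := by linarith
  set X := x^θ with hX
  set M := ⌊3*x⌋₊ with hM
  set D := ⌊x^(θ/3)⌋₊ with hD
  set E := (Finset.Icc 1 M).filter (fun n => ¬ NExc X n) with hE
  have hD3 : (D:ℝ)^3 ≤ X := by
    calc (D:ℝ)^3 ≤ (x^(θ/3))^3 := by
          apply pow_le_pow_left₀ (by positivity)
          exact Nat.floor_le (by positivity)
      _ = X := by
          rw [← Real.rpow_natCast, ← Real.rpow_mul hx0.le, hX]
          congr 1; push_cast; ring
  have hcard := exc_card X M D hD3
  have hsub : (Finset.Ioc ⌊x⌋₊ ⌊2*x⌋₊).filter (fun n => ¬ (NExc X n ∧ NExc X (n+b))) ⊆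
      E ∪ (E.image (fun n => n - b)) := by
    intro n hn
    obtain ⟨h1, h2⟩ := Finset.mem_filter.1 hn
    obtain ⟨h3, h4⟩ := Finset.mem_Ioc.1 h1
    have h5 : (n:ℝ) ≤ 2*x := (Nat.le_floor_iff (by positivity)).1 h4
    have h6 : n + b ≤ M := by
      apply Nat.le_floor
      push_cast; linarith
    rw [Finset.mem_union, Finset.mem_image]
    by_cases h : NExc X n
    · right
      refine ⟨n+b, Finset.mem_filter.2 ⟨Finset.mem_Icc.2 ⟨by omega, h6⟩, fun h' => h2 ⟨h, h'⟩⟩, by omega⟩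
    · left
      exact Finset.mem_filter.2 ⟨Finset.mem_Icc.2 ⟨by omega, by omega⟩, h⟩
  have hc : (((Finset.Ioc ⌊x⌋₊ ⌊2*x⌋₊).filter (fun n => ¬ (NExc X n ∧ NExc X (n+b)))).card : ℝ) ≤ E.card + E.card := by
    have := (Finset.card_le_card hsub).trans ((Finset.card_union_le _ _).trans (Nat.add_le_add_left Finset.card_image_le _))
    exact_mod_cast this
  have hM3 : (M:ℝ) ≤ 3 * x := Nat.floor_le (by positivity)
  have hDl : x^(θ/3) ≤ (D:ℝ) + 1 := (Nat.lt_floor_add_one _).le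
  have : (M:ℝ) * (2 / ((D:ℝ)+1)) ≤ 6 * x^(1-θ/3) := by
    calc (M:ℝ) * (2 / ((D:ℝ)+1)) ≤ 3*x * (2 / x^(θ/3)) := by gcongr
      _ = 6 * x^(1-θ/3) := by
        rw [Real.rpow_sub hx0, Real.rpow_one]; ring
  linarith

noncomputable def uY (x : ℝ) (u : ℕ) : ℝ := if u = 399 then x else x^(1/(u:ℝ))
noncomputable def uH (x : ℝ) (u : ℕ) : ℝ := if u = 399 then 1 else x^((1/8):ℝ)
noncomputable def uβ (B x : ℝ) (u : ℕ) : ℝ := if u = 399 then 0 else B * u / Real.log x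
noncomputable def uz (x : ℝ) (u : ℕ) : ℕ := ⌊x^(1/((u:ℝ)+1))⌋₊

set_option maxHeartbeats 2000000 in
theorem choose_u (b y0 : ℕ) (B x : ℝ) (hB : 1 ≤ B) (hy0 : Real.exp (4*B) ≤ y0) (hx : 3 ≤ x) (hbx : (b:ℝ) ≤ x)
    (hlx : 800 ≤ Real.log x) (hxy : (y0:ℝ)^(16*y0) ≤ x) (n : ℕ) (hn : n ∈ Finset.Ioc ⌊x⌋₊ ⌊2*x⌋₊)
    (e1 : NExc (x^(1/(16*(y0:ℝ)))) n) (e2 : NExc (x^(1/(16*(y0:ℝ)))) (n+b)) :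
    ∃ u s1 s2 : ℕ, 399 ≤ u ∧ 2*((u:ℝ)+1) ≤ Real.log x ∧ (u ≠ 399 → 4*B*u ≤ Real.log x) ∧
      1 ≤ s1 ∧ s1 ≤ 2*(u+1) ∧ s1 ≤ n.primeFactors.card ∧ 1 ≤ s2 ∧ s2 ≤ 2*(u+1) ∧ s2 ≤ (n+b).primeFactors.card ∧
      ∃ a1 a2, Good b x (uH x u) (uY x u) (uz x u) (n.primeFactors.card - s1) ((n+b).primeFactors.card - s2) n a1 a2 := by
  have hx0 : 0 < x := by linarith
  have hx1 : 1 ≤ x := by linarith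
  have hy0pos : (0:ℝ) < y0 := lt_of_lt_of_le (Real.exp_pos _) hy0
  have hy01 : (1:ℝ) ≤ y0 := by
    have : 0 < y0 := by exact_mod_cast hy0pos
    exact_mod_cast this
  obtain ⟨h3, h4⟩ := Finset.mem_Ioc.1 hn
  have hnx : x < n := (Nat.floor_lt hx0.le).1 h3
  have hn2x : (n:ℝ) ≤ 2*x := (Nat.le_floor_iff (by positivity)).1 h4
  set θ := 1/(16*(y0:ℝ)) with hθ
  have hθ0 : 0 < θ := by positivity
  have hθ16 : θ ≤ 1/16 := by
    rw [hθ]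
    apply one_div_le_one_div_of_le (by norm_num)
    linarith
  set X := x^θ with hX
  set Z := x^((1/4):ℝ) with hZ
  have hX1 : 1 ≤ X := Real.one_le_rpow hx1 hθ0.le
  have hZ1 : 1 ≤ Z := Real.one_le_rpow hx1 (by norm_num)
  have hZx : Z ≤ x := by
    calc Z ≤ x^(1:ℝ) := Real.rpow_le_rpow_of_exponent_le hx1 (by norm_num)
      _ = x := Real.rpow_one x
  have hyX : (y0:ℝ) ≤ X := by
    calc (y0:ℝ) = ((y0:ℝ)^(16*y0))^θ := by
          rw [← Real.rpow_natCast, ← Real.rpow_mul hy0pos.le, hθ]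
          push_cast
          rw [mul_one_div_cancel (by positivity), Real.rpow_one]
      _ ≤ X := Real.rpow_le_rpow (by positivity) hxy hθ0.le
  have hXZ : X^(2*y0) ≤ Z := by
    rw [hX, ← Real.rpow_natCast, ← Real.rpow_mul hx0.le]
    apply Real.rpow_le_rpow_of_exponent_le hx1
    rw [hθ]; push_cast
    have : 1 / (16 * (y0:ℝ)) * (2 * y0) = 1/8 := by field_simp; norm_num
    rw [this]; norm_num
  obtain ⟨q, a1, a2, hq, ha1, ha2, d1, d2, hle, hge, hsm, hrough, o1, o2, c1, c2⟩ :=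
    decomp n (n+b) y0 X Z hX1 hZ1 (by linarith) (by push_cast; have : (0:ℝ) ≤ b := by positivity
                                                    linarith) hyX hXZ e1 e2
  have hqy : (y0:ℝ) < q := by exact_mod_cast hq
  have hqpos : (0:ℝ) < q := by linarith
  set ℓ := Real.log x with hℓ
  have hlq : 4*B ≤ Real.log q := by
    rw [Real.le_log_iff_exp_le hqpos]; linarith
  have hlq0 : 0 < Real.log q := by linarith
  set v := ⌊ℓ / Real.log q⌋₊ with hv
  have hv1 : (v:ℝ) * Real.log q ≤ ℓ := by
    rw [← le_div_iff₀ hlq0]; exact Nat.floor_le (by positivity)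
  have hv2 : ℓ < ((v:ℝ)+1) * Real.log q := by
    rw [← div_lt_iff₀ hlq0]; exact Nat.lt_floor_add_one _
  set u := max 399 v with hu
  have hvu : (v:ℝ) ≤ u := by exact_mod_cast le_max_right 399 v
  have hu2 : ℓ < ((u:ℝ)+1) * Real.log q := by nlinarith
  have huv : u ≠ 399 → u = v := by intro h; omega
  have hu399 : 399 ≤ u := le_max_left _ _
  have hu399' : (399:ℝ) ≤ u := by exact_mod_cast hu399
  have h4B : u ≠ 399 → 4*B*u ≤ ℓ := by
    intro h
    rw [← huv h] at hv1
    nlinarith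
  have h2u : 2*((u:ℝ)+1) ≤ ℓ := by
    by_cases h : u = 399
    · rw [h]; norm_num; linarith
    · have := h4B h
      nlinarith
  have hzq : x^(1/((u:ℝ)+1)) < q := by
    rw [Real.rpow_def_of_pos hx0, ← Real.lt_log_iff_exp_lt hqpos, mul_one_div, div_lt_iff₀ (by positivity)]
    linarith
  have hqY : u ≠ 399 → (q:ℝ) ≤ x^(1/(u:ℝ)) := by
    intro h
    rw [Real.rpow_def_of_pos hx0, ← Real.log_le_iff_le_exp hqpos, mul_one_div, le_div_iff₀ (by positivity)]
    rw [← huv h] at hv1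
    linarith
  have hsb : ∀ s m : ℕ, m ≤ n + b → q^s ≤ m → s ≤ 2*(u+1) := by
    intro s m hm hqs
    have h5 : ((q:ℝ)^s) ≤ x^2 := by
      have : ((q:ℝ)^s) ≤ m := by exact_mod_cast hqs
      have h6 : (m:ℝ) ≤ n + b := by exact_mod_cast hm
      nlinarith
    have h6 := Real.log_le_log (by positivity) h5
    rw [Real.log_pow, Real.log_pow] at h6
    by_contra hc
    have h7 : 2*((u:ℝ)+1) ≤ s := by
      have : 2*(u+1) ≤ s := by omega
      exact_mod_cast this
    have h8 : 2*((u:ℝ)+1) * Real.log q ≤ s * Real.log q := by gcongr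
    push_cast at h6
    rw [← hℓ] at h6
    linarith
  have h1z : (1:ℝ) ≤ (a1:ℝ) := by exact_mod_cast ha1
  have h2z : (1:ℝ) ≤ (a2:ℝ) := by exact_mod_cast ha2
  refine ⟨u, n.primeFactors.card - a1.primeFactors.card, (n+b).primeFactors.card - a2.primeFactors.card, hu399, h2u, h4B,
    by omega, hsb _ n (by omega) c1, by omega, by omega, hsb _ (n+b) le_rfl c2, by omega, a1, a2, ?_⟩
  refine ⟨ha1, ha2, d1, d2, ?_, hle, by omega, by omega, ?_, ?_⟩
  · unfold uH
    split_ifs with h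
    · nlinarith
    · have hqx : (q:ℝ) ≤ x^((1/16):ℝ) := by
        refine (hqY h).trans (Real.rpow_le_rpow_of_exponent_le hx1 ?_)
        apply one_div_le_one_div_of_le (by norm_num); linarith
      have hXx : X ≤ x^((1/16):ℝ) := Real.rpow_le_rpow_of_exponent_le hx1 hθ16
      have hmax : (max (q:ℝ) X)^2 ≤ x^((1/8):ℝ) := by
        calc (max (q:ℝ) X)^2 ≤ (x^((1/16):ℝ))^2 := pow_le_pow_left₀ (by positivity) (max_le hqx hXx) _
          _ = _ := by rw [← Real.rpow_natCast, ← Real.rpow_mul hx0.le]; norm_num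
      have hZ8 : Z = x^((1/8):ℝ) * x^((1/8):ℝ) := by rw [← Real.rpow_add hx0]; norm_num [hZ]
      have h9 : x^((1/8):ℝ) * x^((1/8):ℝ) ≤ (a1:ℝ) * a2 * x^((1/8):ℝ) := by
        rw [← hZ8]; refine hge.trans ?_; gcongr
      exact le_of_mul_le_mul_right h9 (by positivity)
  · intro p hp hpd
    unfold uY
    split_ifs with h
    · have h5 : p ≤ a1 * a2 := Nat.le_of_dvd (Nat.mul_pos ha1 ha2) hpd
      have h6 : (p:ℝ) ≤ (a1:ℝ) * a2 := by exact_mod_cast h5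
      linarith
    · have h5 : (p:ℝ) ≤ q := by exact_mod_cast (hsm p hp hpd).le
      exact h5.trans (hqY h)
  · intro p hp hpz hnd
    apply hrough p hp _ hnd
    have h5 : (p:ℝ) ≤ x^(1/((u:ℝ)+1)) := (Nat.le_floor_iff (by positivity)).1 hpz
    have : (p:ℝ) < q := by linarith
    exact_mod_cast this

theorem uz_facts (x : ℝ) (hx : 3 ≤ x) (u : ℕ) (hu : 399 ≤ u) (h2 : 2*((u:ℝ)+1) ≤ Real.log x) :
    2 ≤ uz x u ∧ Real.log x / (2*((u:ℝ)+1)) ≤ Real.log (uz x u) ∧ (uz x u : ℝ)^96 ≤ x^((1/4):ℝ) := by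
  have hx0 : 0 < x := by linarith
  have hx1 : 1 ≤ x := by linarith
  have hu' : (399:ℝ) ≤ u := by exact_mod_cast hu
  set w := x^(1/((u:ℝ)+1)) with hw
  have hw0 : 0 < w := by positivity
  have hlw : Real.log w = Real.log x / ((u:ℝ)+1) := by
    rw [hw, Real.log_rpow hx0]; ring
  have hw4 : 4 ≤ w := by
    have h3 : 2 ≤ Real.log w := by
      rw [hlw, le_div_iff₀ (by positivity)]; linarith
    rw [Real.le_log_iff_exp_le hw0] at h3
    have h4 : Real.exp 2 = Real.exp 1 * Real.exp 1 := by rw [← Real.exp_add]; norm_num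
    have := Real.exp_one_gt_d9
    nlinarith
  have hz2 : w/2 ≤ (uz x u : ℝ) := by
    have : w < (uz x u : ℝ) + 1 := Nat.lt_floor_add_one w
    linarith
  have hzw : (uz x u : ℝ) ≤ w := Nat.floor_le hw0.le
  refine ⟨?_, ?_, ?_⟩
  · apply Nat.le_floor; push_cast; linarith
  · have hs : Real.sqrt w ≤ w/2 := by
      rw [Real.sqrt_le_left (by positivity)]
      nlinarith
    calc Real.log x / (2*((u:ℝ)+1)) = Real.log (Real.sqrt w) := by
          rw [Real.log_sqrt hw0.le, hlw]; field_simp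
      _ ≤ Real.log (uz x u) := Real.log_le_log (Real.sqrt_pos.2 hw0) (hs.trans hz2)
  · calc (uz x u : ℝ)^96 ≤ w^96 := pow_le_pow_left₀ (by positivity) hzw _
      _ = x^((96:ℝ)/((u:ℝ)+1)) := by
        rw [hw, ← Real.rpow_natCast, ← Real.rpow_mul hx0.le]
        congr 1; push_cast; ring
      _ ≤ _ := by
        apply Real.rpow_le_rpow_of_exponent_le hx1
        rw [div_le_div_iff₀ (by positivity) (by norm_num)]; linarith

set_option maxHeartbeats 1000000 in
theorem block_u (R : ℝ) (hR : 1 ≤ R) (b : ℕ) (hb : 1 ≤ b) (B : ℝ) (hB : B = 8*(4*Real.log R + 1)) : ∃ K : ℝ, 0 < K ∧ ∀ x : ℝ, 3 ≤ x →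
    ∀ k1 k2 : ℕ, (k1:ℝ) ≤ R * Real.log (Real.log x) → (k2:ℝ) ≤ R * Real.log (Real.log x) →
    ∀ u s1 s2 : ℕ, 399 ≤ u → 2*((u:ℝ)+1) ≤ Real.log x → (u ≠ 399 → 4*B*u ≤ Real.log x) →
      1 ≤ s1 → s1 ≤ 2*(u+1) → s1 ≤ k1 → 1 ≤ s2 → s2 ≤ 2*(u+1) → s2 ≤ k2 →
    ∀ W : Finset ℕ, W ⊆ Finset.Ioc ⌊x⌋₊ ⌊2*x⌋₊ →
    (∀ n ∈ W, ∃ a1 a2, Good b x (uH x u) (uY x u) (uz x u) (k1 - s1) (k2 - s2) n a1 a2) →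
    (W.card : ℝ) ≤ K * (x * ((Real.log (Real.log x))^(k1-1) / ((k1-1).factorial : ℝ)) * ((Real.log (Real.log x))^(k2-1) / ((k2-1).factorial : ℝ)) / (Real.log x)^2)
      * (((u:ℝ)+1)^2 * Real.exp (-(u:ℝ))) + x^((3/4):ℝ) := by
  have hlR := Real.log_nonneg hR
  have hB1 : 1 ≤ B := by rw [hB]; linarith
  obtain ⟨C, hC, hblock⟩ := block B (by linarith) b hb
  refine ⟨8 * C * Real.exp (50*B) * (Real.exp (C*R))^2 * R^4, by positivity, ?_⟩
  intro x hx k1 k2 hk1 hk2 u s1 s2 hu h2u h4B hs1 hs1u hs1k hs2 hs2u hs2k W hW hWg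
  have hx0 : 0 < x := by linarith
  have hx1 : 1 ≤ x := by linarith
  have hu' : (399:ℝ) ≤ u := by exact_mod_cast hu
  have hL := loglog_pos x hx
  obtain ⟨z2, zl, z96⟩ := uz_facts x hx u hu h2u
  have hlx : 0 < Real.log x := by linarith
  have hN : ⌊x⌋₊ ≤ ⌊2*x⌋₊ := Nat.floor_le_floor (by linarith)
  have hY1 : 1 ≤ uY x u := by
    unfold uY; split_ifs
    · exact hx1
    · exact Real.one_le_rpow hx1 (by positivity)
  have hYx : uY x u ≤ x := by
    unfold uY; split_ifs
    · exact le_rfl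
    · calc x^(1/(u:ℝ)) ≤ x^(1:ℝ) := by
            apply Real.rpow_le_rpow_of_exponent_le hx1
            rw [div_le_one (by positivity)]; linarith
        _ = x := Real.rpow_one x
  have hβ0 : 0 ≤ uβ B x u := by
    unfold uβ; split_ifs
    · exact le_rfl
    · positivity
  have hβ4 : uβ B x u ≤ 1/4 := by
    unfold uβ; split_ifs with h
    · norm_num
    · rw [div_le_iff₀ hlx]; have := h4B h; linarith
  have hβY : uβ B x u * Real.log (uY x u) ≤ B := by
    unfold uβ uY; split_ifs with h
    · linarith
    · rw [Real.log_rpow hx0]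
      have : B * u / Real.log x * (1 / (u:ℝ) * Real.log x) = B := by field_simp
      rw [this]
  have hH0 : 0 < uH x u := by
    unfold uH; split_ifs
    · norm_num
    · positivity
  have hHβ : (uH x u)^(-(uβ B x u)) ≤ Real.exp (50*B) * Real.exp (-(B*u/8)) := by
    rw [← Real.exp_add]
    unfold uH uβ; split_ifs with h
    · rw [Real.one_rpow, h]
      apply Real.one_le_exp
      push_cast; linarith
    · rw [← Real.rpow_mul hx0.le, Real.rpow_def_of_pos hx0]
      apply Real.exp_le_exp.2
      have : Real.log x * (1/8 * -(B * u / Real.log x)) = -(B*u/8) := by field_simp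
      rw [this]; linarith
  have hmain := hblock x hx ⌊x⌋₊ ⌊2*x⌋₊ (uz x u) hN z2 (uY x u) (uβ B x u) (uH x u) hY1 hYx hβ0 hβ4 hβY hH0 (k1-s1) (k2-s2) W hW hWg
  have hr1 := ratio_lem R C _ hR hC.le hL k1 s1 hs1 hs1k hk1
  have hr2 := ratio_lem R C _ hR hC.le hL k2 s2 hs2 hs2k hk2
  have hp1 : R^(s1-1) ≤ R^(2*(u+1)) := pow_le_pow_right₀ hR (by omega)
  have hp2 : R^(s2-1) ≤ R^(2*(u+1)) := pow_le_pow_right₀ hR (by omega)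
  have hexp : Real.exp (-(B*u/8)) * (R^(2*(u+1)) * R^(2*(u+1))) = R^4 * Real.exp (-(u:ℝ)) := by
    have e1 : R^(2*(u+1)) * R^(2*(u+1)) = R^4 * Real.exp (4 * Real.log R * u) := by
      have : Real.exp (4 * Real.log R * u) = (R^4)^u := by
        rw [mul_comm, Real.exp_nat_mul]
        congr 1
        rw [show (4:ℝ) * Real.log R = ((4:ℕ):ℝ) * Real.log R by norm_num, Real.exp_nat_mul, Real.exp_log (by linarith)]
      rw [this, ← pow_mul, ← pow_add, ← pow_add]; congr 1; ring
    rw [e1, show Real.exp (-(B*u/8)) * (R^4 * Real.exp (4 * Real.log R * u)) = R^4 * (Real.exp (-(B*u/8)) * Real.exp (4 * Real.log R * u)) by ring, ← Real.exp_add]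
    congr 2; rw [hB]; ring
  have hNN : ((⌊2*x⌋₊:ℕ):ℝ) - ((⌊x⌋₊:ℕ):ℝ) ≤ 2*x := by
    have h1 : ((⌊2*x⌋₊:ℕ):ℝ) ≤ 2*x := Nat.floor_le (by positivity)
    have h2 : (0:ℝ) ≤ ((⌊x⌋₊:ℕ):ℝ) := by positivity
    linarith
  have hNN0 : 0 ≤ ((⌊2*x⌋₊:ℕ):ℝ) - ((⌊x⌋₊:ℕ):ℝ) := by
    have : ((⌊x⌋₊:ℕ):ℝ) ≤ ((⌊2*x⌋₊:ℕ):ℝ) := by exact_mod_cast hN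
    linarith
  have herr : x^((1/2):ℝ) * (uz x u : ℝ)^96 ≤ x^((3/4):ℝ) := by
    calc _ ≤ x^((1/2):ℝ) * x^((1/4):ℝ) := by gcongr
      _ = _ := by rw [← Real.rpow_add hx0]; norm_num
  refine hmain.trans (add_le_add ?_ herr)
  set T1 := (Real.log (Real.log x))^(k1-1) / ((k1-1).factorial : ℝ) with hT1
  set T2 := (Real.log (Real.log x))^(k2-1) / ((k2-1).factorial : ℝ) with hT2
  have hT10 : 0 ≤ T1 := by positivity
  have hT20 : 0 ≤ T2 := by positivity
  have hlz : 0 < Real.log x / (2*((u:ℝ)+1)) := by positivity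
  calc _ ≤ C * (2*x) / (Real.log x / (2*((u:ℝ)+1)))^2 * (Real.exp (50*B) * Real.exp (-(B*u/8))) *
        ((Real.exp (C*R) * R^(2*(u+1)) * T1) * (Real.exp (C*R) * R^(2*(u+1)) * T2)) := by
          gcongr
          · exact hr1.trans (by gcongr)
          · exact hr2.trans (by gcongr)
    _ = C * (2*x) / (Real.log x / (2*((u:ℝ)+1)))^2 * Real.exp (50*B) * (Real.exp (C*R))^2 * T1 * T2 *
        (Real.exp (-(B*u/8)) * (R^(2*(u+1)) * R^(2*(u+1)))) := by ring
    _ = _ := by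
          rw [hexp]
          field_simp
          ring

noncomputable def MM (x : ℝ) (k1 k2 : ℕ) : ℝ :=
  x * ((Real.log (Real.log x))^(k1-1) / ((k1-1).factorial : ℝ)) * ((Real.log (Real.log x))^(k2-1) / ((k2-1).factorial : ℝ)) / (Real.log x)^2

noncomputable def SS (b : ℕ) (x : ℝ) (k1 k2 : ℕ) : Finset ℕ :=
  (Finset.Ioc ⌊x⌋₊ ⌊2*x⌋₊).filter (fun n => smallOmega n = k1 ∧ smallOmega (n+b) = k2)

theorem exp_sum : ∃ S : ℝ, 0 < S ∧ ∀ N : ℕ, ∑ u ∈ Finset.range N, ((u:ℝ)+1)^4 * Real.exp (-(u:ℝ)) ≤ S := by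
  have h := Real.summable_pow_mul_exp_neg_nat_mul 4 (r := 1) one_pos
  have h2 := (summable_nat_add_iff 1).2 h
  have h3 : Summable (fun u : ℕ => ((u:ℝ)+1)^4 * Real.exp (-(u:ℝ))) := by
    refine (h2.mul_left (Real.exp 1)).congr ?_
    intro u
    have : Real.exp (-(u:ℝ)) = Real.exp 1 * Real.exp (-1 * ((u+1 : ℕ):ℝ)) := by
      rw [← Real.exp_add]; congr 1; push_cast; ring
    rw [this]; push_cast; ring
  have h4 : ∀ u : ℕ, 0 ≤ ((u:ℝ)+1)^4 * Real.exp (-(u:ℝ)) := fun u => by positivity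
  refine ⟨∑' u : ℕ, ((u:ℝ)+1)^4 * Real.exp (-(u:ℝ)) + 1, add_pos_of_nonneg_of_pos (tsum_nonneg h4) one_pos, ?_⟩
  intro N
  have := h3.sum_le_tsum (Finset.range N) (fun u _ => h4 u)
  linarith

theorem MM_nonneg (x : ℝ) (hx : 3 ≤ x) (k1 k2 : ℕ) : 0 ≤ MM x k1 k2 := by
  have := loglog_pos x hx
  unfold MM
  positivity

theorem large_x (R : ℝ) (hR : 1 ≤ R) (b : ℕ) (hb : 1 ≤ b) : ∃ C x0 : ℝ, 0 < C ∧ 0 < x0 ∧ ∀ x : ℝ, 3 ≤ x → x0 ≤ x →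
    ∀ k1 k2 : ℕ, (k1:ℝ) ≤ R * Real.log (Real.log x) → (k2:ℝ) ≤ R * Real.log (Real.log x) →
    ((SS b x k1 k2).card : ℝ) ≤ C * MM x k1 k2 := by
  obtain ⟨B, hB⟩ : ∃ B, B = 8*(4*Real.log R + 1) := ⟨_, rfl⟩
  have hB1 : 1 ≤ B := by rw [hB]; have := Real.log_nonneg hR; linarith
  obtain ⟨y0, hy0⟩ := exists_nat_ge (Real.exp (4*B))
  have hy0pos : (0:ℝ) < y0 := lt_of_lt_of_le (Real.exp_pos _) hy0
  obtain ⟨K, hK, hblk⟩ := block_u R hR b hb B hB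
  obtain ⟨θ, hθ⟩ : ∃ θ, θ = 1/(16*(y0:ℝ)) := ⟨_, rfl⟩
  have hθ0 : 0 < θ := by rw [hθ]; positivity
  obtain ⟨C1, hC1, ha1⟩ := absorb R (θ/3) hR (by positivity) 0
  obtain ⟨C2, hC2, ha2⟩ := absorb R (1/4) hR (by norm_num) 3
  obtain ⟨S, hS, hsum⟩ := exp_sum
  refine ⟨12*C1 + (4*K*S + 4*C2), b + Real.exp 800 + (y0:ℝ)^(16*y0), by positivity, by positivity, ?_⟩
  intro x hx hxx k1 k2 hk1 hk2
  have hx0 : 0 < x := by linarith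
  have hp1 : (0:ℝ) ≤ b := by positivity
  have hp2 : 0 ≤ Real.exp 800 := (Real.exp_pos _).le
  have hp3 : 0 ≤ (y0:ℝ)^(16*y0) := by positivity
  have hbx : (b:ℝ) ≤ x := by linarith
  have hlx : 800 ≤ Real.log x := by rw [Real.le_log_iff_exp_le hx0]; linarith
  have hxy : (y0:ℝ)^(16*y0) ≤ x := by linarith
  have hM0 := MM_nonneg x hx k1 k2
  have hA1 := ha1 x hx k1 k2 hk1 hk2
  have hA2 := ha2 x hx k1 k2 hk1 hk2
  have hexc := exc_bound b hb x θ hx hbx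
  set E := (Finset.Ioc ⌊x⌋₊ ⌊2*x⌋₊).filter (fun n => ¬ (NExc (x^θ) n ∧ NExc (x^θ) (n+b))) with hE
  set W : ℕ → ℕ × ℕ → Finset ℕ := fun u s => (SS b x k1 k2).filter (fun n =>
    (399 ≤ u ∧ 2*((u:ℝ)+1) ≤ Real.log x ∧ (u ≠ 399 → 4*B*u ≤ Real.log x) ∧
      1 ≤ s.1 ∧ s.1 ≤ 2*(u+1) ∧ s.1 ≤ k1 ∧ 1 ≤ s.2 ∧ s.2 ≤ 2*(u+1) ∧ s.2 ≤ k2) ∧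
      ∃ a1 a2, Good b x (uH x u) (uY x u) (uz x u) (k1 - s.1) (k2 - s.2) n a1 a2) with hW
  set J : ℕ → Finset (ℕ × ℕ) := fun u => Finset.Icc 1 (2*(u+1)) ×ˢ Finset.Icc 1 (2*(u+1)) with hJ
  set N := ⌊Real.log x⌋₊ with hN
  have hNl : (N:ℝ) ≤ Real.log x := Nat.floor_le (by linarith)
  have hsub : SS b x k1 k2 ⊆ E ∪ (Finset.range N).biUnion (fun u => (J u).biUnion (W u)) := by
    intro n hn
    have hn' := hn
    unfold SS at hn
    obtain ⟨hI, ho1, ho2⟩ := Finset.mem_filter.1 hn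
    rw [Finset.mem_union]
    by_cases he : NExc (x^θ) n ∧ NExc (x^θ) (n+b)
    · right
      rw [hθ] at he
      obtain ⟨u, s1, s2, c1, c2, c3, c4, c5, c6, c7, c8, c9, c10⟩ := choose_u b y0 B x hB1 hy0 hx hbx hlx hxy n hI he.1 he.2
      unfold smallOmega at ho1 ho2
      rw [ho1] at c6
      rw [ho2] at c9
      rw [ho1, ho2] at c10
      rw [Finset.mem_biUnion]
      refine ⟨u, ?_, ?_⟩
      · rw [Finset.mem_range]
        apply Nat.lt_of_succ_le
        apply Nat.le_floor
        push_cast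
        have : (0:ℝ) ≤ u := by positivity
        linarith
      · rw [Finset.mem_biUnion]
        refine ⟨(s1, s2), ?_, ?_⟩
        · rw [hJ, Finset.mem_product, Finset.mem_Icc, Finset.mem_Icc]
          exact ⟨⟨c4, c5⟩, ⟨c7, c8⟩⟩
        · rw [hW, Finset.mem_filter]
          exact ⟨hn', ⟨c1, c2, c3, c4, c5, c6, c7, c8, c9⟩, c10⟩
    · left
      exact Finset.mem_filter.2 ⟨hI, he⟩
  have hWb : ∀ u s, ((W u s).card : ℝ) ≤ K * MM x k1 k2 * (((u:ℝ)+1)^2 * Real.exp (-(u:ℝ))) + x^((3/4):ℝ) := by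
    intro u s
    by_cases hc : (399 ≤ u ∧ 2*((u:ℝ)+1) ≤ Real.log x ∧ (u ≠ 399 → 4*B*u ≤ Real.log x) ∧
      1 ≤ s.1 ∧ s.1 ≤ 2*(u+1) ∧ s.1 ≤ k1 ∧ 1 ≤ s.2 ∧ s.2 ≤ 2*(u+1) ∧ s.2 ≤ k2)
    · obtain ⟨c1, c2, c3, c4, c5, c6, c7, c8, c9⟩ := hc
      exact hblk x hx k1 k2 hk1 hk2 u s.1 s.2 c1 c2 c3 c4 c5 c6 c7 c8 c9 (W u s)
        ((Finset.filter_subset _ _).trans (Finset.filter_subset _ _))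
        (fun n hn => (Finset.mem_filter.1 hn).2.2)
    · have : W u s = ∅ := by
        rw [hW]
        apply Finset.filter_eq_empty_iff.2
        intro n _ h
        exact hc h.1
      rw [this]
      simp only [Finset.card_empty, Nat.cast_zero]
      positivity
  have hJb : ∀ u ∈ Finset.range N, (((J u).biUnion (W u)).card : ℝ) ≤
      4*K*MM x k1 k2 * (((u:ℝ)+1)^4 * Real.exp (-(u:ℝ))) + 4 * (Real.log x)^2 * x^((3/4):ℝ) := by
    intro u hu
    have hu1 : (u:ℝ)+1 ≤ Real.log x := by
      have : u + 1 ≤ N := Finset.mem_range.1 hu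
      have : ((u+1 : ℕ):ℝ) ≤ N := by exact_mod_cast this
      push_cast at this
      linarith
    have hcJ : ((J u).card : ℝ) = 4 * ((u:ℝ)+1)^2 := by
      rw [hJ, Finset.card_product, Nat.card_Icc]; push_cast
      ring
    calc (((J u).biUnion (W u)).card : ℝ) ≤ ∑ s ∈ J u, ((W u s).card : ℝ) := by
          exact_mod_cast Finset.card_biUnion_le
      _ ≤ ∑ s ∈ J u, (K * MM x k1 k2 * (((u:ℝ)+1)^2 * Real.exp (-(u:ℝ))) + x^((3/4):ℝ)) :=
          Finset.sum_le_sum fun s _ => hWb u s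
      _ = 4*K*MM x k1 k2 * (((u:ℝ)+1)^4 * Real.exp (-(u:ℝ))) + 4 * ((u:ℝ)+1)^2 * x^((3/4):ℝ) := by
          rw [Finset.sum_const, nsmul_eq_mul, hcJ]; ring
      _ ≤ _ := by gcongr
  have htot : ((SS b x k1 k2).card : ℝ) ≤ E.card + ∑ u ∈ Finset.range N, (((J u).biUnion (W u)).card : ℝ) := by
    have := (Finset.card_le_card hsub).trans ((Finset.card_union_le _ _).trans (Nat.add_le_add_left Finset.card_biUnion_le _))
    exact_mod_cast this
  have hfin : ∑ u ∈ Finset.range N, (((J u).biUnion (W u)).card : ℝ) ≤ (4*K*S + 4*C2) * MM x k1 k2 := by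
    calc _ ≤ ∑ u ∈ Finset.range N, (4*K*MM x k1 k2 * (((u:ℝ)+1)^4 * Real.exp (-(u:ℝ))) + 4 * (Real.log x)^2 * x^((3/4):ℝ)) :=
          Finset.sum_le_sum hJb
      _ = 4*K*MM x k1 k2 * ∑ u ∈ Finset.range N, (((u:ℝ)+1)^4 * Real.exp (-(u:ℝ))) + N * (4 * (Real.log x)^2 * x^((3/4):ℝ)) := by
          rw [Finset.sum_add_distrib, ← Finset.mul_sum, Finset.sum_const, nsmul_eq_mul, Finset.card_range]
      _ ≤ 4*K*MM x k1 k2 * S + Real.log x * (4 * (Real.log x)^2 * x^((3/4):ℝ)) := by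
          gcongr
          exact hsum N
      _ = 4*K*MM x k1 k2 * S + 4 * ((Real.log x)^3 * x^(1-(1/4):ℝ)) := by
          rw [show (1-(1/4):ℝ) = 3/4 by norm_num]; ring
      _ ≤ 4*K*MM x k1 k2 * S + 4 * (C2 * MM x k1 k2) := by
          exact add_le_add le_rfl (mul_le_mul_of_nonneg_left hA2 (by norm_num))
      _ = _ := by ring
  have hA1' : x^(1-θ/3) ≤ C1 * MM x k1 k2 := by
    rw [pow_zero, one_mul] at hA1
    exact hA1
  linarith

theorem all_x (R : ℝ) (hR : 1 ≤ R) (b : ℕ) (hb : 1 ≤ b) : ∃ C : ℝ, 0 < C ∧ ∀ x : ℝ, 3 ≤ x →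
    ∀ k1 k2 : ℕ, (k1:ℝ) ≤ R * Real.log (Real.log x) → (k2:ℝ) ≤ R * Real.log (Real.log x) →
    ((SS b x k1 k2).card : ℝ) ≤ C * MM x k1 k2 := by
  obtain ⟨C, x0, hC, hx0, h⟩ := large_x R hR b hb
  obtain ⟨C1, hC1, ha1⟩ := absorb R 1 hR one_pos 0
  refine ⟨C + 2*x0*C1, by positivity, ?_⟩
  intro x hx k1 k2 hk1 hk2
  have hM0 := MM_nonneg x hx k1 k2
  rcases le_total x0 x with hxx | hxx
  · refine (h x hx hxx k1 k2 hk1 hk2).trans ?_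
    gcongr
    have : 0 ≤ 2*x0*C1 := by positivity
    linarith
  · have h1 : 1 ≤ C1 * MM x k1 k2 := by
      have := ha1 x hx k1 k2 hk1 hk2
      rw [pow_zero, one_mul, sub_self, Real.rpow_zero] at this
      exact this
    have h2 : ((SS b x k1 k2).card : ℝ) ≤ 2*x := by
      have h3 : (SS b x k1 k2).card ≤ ⌊2*x⌋₊ := by
        unfold SS
        refine (Finset.card_filter_le _ _).trans ?_
        rw [Nat.card_Ioc]; omega
      calc ((SS b x k1 k2).card : ℝ) ≤ (⌊2*x⌋₊ : ℝ) := by exact_mod_cast h3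
        _ ≤ 2*x := Nat.floor_le (by linarith)
    have h4 : 2*x0*1 ≤ 2*x0*(C1 * MM x k1 k2) := by gcongr
    have h5 : 0 ≤ C * MM x k1 k2 := by positivity
    calc _ ≤ 2*x := h2
      _ ≤ C * MM x k1 k2 + 2*x0*(C1 * MM x k1 k2) := by linarith
      _ = _ := by ring

theorem final (R : ℝ) (hR : 0 < R) (b : ℕ) (hb : 1 ≤ b) :
    ∃ C : ℝ, 0 < C ∧ ∀ x : ℝ, 3 ≤ x → ∀ k₁ k₂ : ℕ, 1 ≤ k₁ → (k₁:ℝ) ≤ R * log₂ x → 1 ≤ k₂ → (k₂:ℝ) ≤ R * log₂ x →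
    (((Finset.Ioc ⌊x⌋₊ ⌊2*x⌋₊).filter (fun n => smallOmega n = k₁ ∧ smallOmega (n+b) = k₂)).card : ℝ) ≤
      C * (deltak k₁ x * deltak k₂ x * x) := by
  obtain ⟨C, hC, h⟩ := all_x (max 1 R) (le_max_left _ _) b hb
  obtain ⟨c, hc, hlam⟩ := lam_lb R hR
  refine ⟨C / c^2, by positivity, ?_⟩
  intro x hx k1 k2 h1 hk1 h2 hk2
  have hL := loglog_pos x hx
  have hlx : 0 < Real.log x := Real.log_pos (by linarith)
  have hdel : ∀ k : ℕ, 1 ≤ k → (k:ℝ) ≤ R * log₂ x → c * ((Real.log (Real.log x))^(k-1) / ((k-1).factorial : ℝ)) / Real.log x ≤ deltak k x := by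
    intro k hk hkR
    have hk' : (1:ℝ) ≤ k := by exact_mod_cast hk
    unfold log₂ at hkR
    have hl := hlam (((k:ℝ)-1)/Real.log (Real.log x)) (div_nonneg (by linarith) hL.le) (by
      rw [div_le_iff₀ hL]; linarith)
    unfold deltak log₂
    calc _ = c * ((Real.log (Real.log x))^(k-1) / (Real.log x * ((k-1).factorial : ℝ))) := by field_simp
      _ ≤ lambdaFn (((k:ℝ)-1)/Real.log (Real.log x)) * ((Real.log (Real.log x))^(k-1) / (Real.log x * ((k-1).factorial : ℝ))) := by gcongr
      _ = _ := by ring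
  have hle : ∀ k : ℕ, (k:ℝ) ≤ R * log₂ x → (k:ℝ) ≤ max 1 R * Real.log (Real.log x) := by
    intro k hk
    refine hk.trans ?_
    unfold log₂
    gcongr
    exact le_max_right _ _
  have hmain := h x hx k1 k2 (hle k1 hk1) (hle k2 hk2)
  have d1 := hdel k1 h1 hk1
  have d2 := hdel k2 h2 hk2
  refine le_trans hmain ?_
  have hd1 : 0 ≤ deltak k1 x := le_trans (by positivity) d1
  have e : C * MM x k1 k2 = C / c^2 * ((c * ((Real.log (Real.log x))^(k1-1) / ((k1-1).factorial : ℝ)) / Real.log x) * (c * ((Real.log (Real.log x))^(k2-1) / ((k2-1).factorial : ℝ)) / Real.log x) * x) := by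
    unfold MM; field_simp
  rw [e]
  gcongr

theorem stmt2 (R : ℝ) (hR : 0 < R) (b : ℕ) (hb : 1 ≤ b) :
    ∃ C : ℝ, 0 < C ∧ ∀ x : ℝ, 3 ≤ x → ∀ k₁ k₂ : ℕ,
      1 ≤ k₁ → (k₁ : ℝ) ≤ R * log₂ x →
      1 ≤ k₂ → (k₂ : ℝ) ≤ R * log₂ x →
      (((Finset.Ioc ⌊x⌋₊ ⌊2 * x⌋₊).filter
          (fun n => smallOmega n = k₁ ∧ smallOmega (n + b) = k₂)).card : ℝ)
        ≤ C * (deltak k₁ x * deltak k₂ x * x) := by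
  exact final R hR b hb
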